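/- There are universal constants C and c such that: in every directed polymatroidal network on n ≥ 2 nodes, for any multicommodity flow instance with k source-sink pairs, if β is the value of the maximum throughput multicommodity flow, then there exists a feasible multicut F with ν(F) ≤ C·n^{11/23}·(log n)^c·β. -/

import Mathlib

open Finset MeasureTheory
open scoped ENNReal Classical

/-- A directed polymatroidal network: a finite directed graph together with,
for each node `v`, polymatroids `rhoM v` on the edges entering `v` and
`rhoP v` on the edges leaving `v`. -/
structure DirPolyNet (V E : Type) [Fintype V] [Fintype E] [DecidableEq V] [DecidableEq E] where
  tail : E → V
  head : E → V
  rhoM : V → Finset E → ℝ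
  rhoP : V → Finset E → ℝ
  rhoM_empty : ∀ v, rhoM v ∅ = 0
  rhoP_empty : ∀ v, rhoP v ∅ = 0
  rhoM_nonneg : ∀ v A, A ⊆ Finset.univ.filter (fun e => head e = v) → 0 ≤ rhoM v A
  rhoP_nonneg : ∀ v A, A ⊆ Finset.univ.filter (fun e => tail e = v) → 0 ≤ rhoP v A
  rhoM_mono : ∀ v A B, A ⊆ B → B ⊆ Finset.univ.filter (fun e => head e = v) →
    rhoM v A ≤ rhoM v B
  rhoP_mono : ∀ v A B, A ⊆ B → B ⊆ Finset.univ.filter (fun e => tail e = v) →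
    rhoP v A ≤ rhoP v B
  rhoM_submod : ∀ v A B, A ⊆ Finset.univ.filter (fun e => head e = v) →
    B ⊆ Finset.univ.filter (fun e => head e = v) →
    rhoM v (A ∪ B) + rhoM v (A ∩ B) ≤ rhoM v A + rhoM v B
  rhoP_submod : ∀ v A B, A ⊆ Finset.univ.filter (fun e => tail e = v) →
    B ⊆ Finset.univ.filter (fun e => tail e = v) →
    rhoP v (A ∪ B) + rhoP v (A ∩ B) ≤ rhoP v A + rhoP v B

namespace DirPolyNet

variable {V E : Type} [Fintype V] [Fintype E] [DecidableEq V] [DecidableEq E]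

/-- The set of edges entering `v` (the ground set of `rhoM v`). -/
def inE (N : DirPolyNet V E) (v : V) : Finset E :=
  Finset.univ.filter (fun e => N.head e = v)

/-- The set of edges leaving `v` (the ground set of `rhoP v`). -/
def outE (N : DirPolyNet V E) (v : V) : Finset E :=
  Finset.univ.filter (fun e => N.tail e = v)

/-- `g` is a valid assignment of the edges of `F` to endpoints. -/
def Valid (N : DirPolyNet V E) (F : Finset E) (g : E → V) : Prop :=
  ∀ e ∈ F, g e = N.tail e ∨ g e = N.head e

/-- The cost `ν(F)` of the edge cut `F`: the minimum over valid assignments `g`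
of `Σ_v (ρ⁻_v(δ⁻(v) ∩ g⁻¹(v)) + ρ⁺_v(δ⁺(v) ∩ g⁻¹(v)))`. -/
noncomputable def cutCost (N : DirPolyNet V E) (F : Finset E) : ℝ :=
  sInf { c : ℝ | ∃ g : E → V, N.Valid F g ∧
    c = ∑ v : V, (N.rhoM v ((N.inE v ∩ F).filter (fun e => g e = v)) +
                  N.rhoP v ((N.outE v ∩ F).filter (fun e => g e = v))) }

/-- `IsWalk N s t p`: the list of edges `p` forms a directed walk from `s` to `t`. -/
def IsWalk (N : DirPolyNet V E) : V → V → List E → Prop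
  | s, t, [] => s = t
  | s, t, e :: p => N.tail e = s ∧ IsWalk N (N.head e) t p

/-- The list of vertices visited by a walk starting at `s`. -/
def walkVerts (N : DirPolyNet V E) : V → List E → List V
  | s, [] => [s]
  | s, e :: p => s :: walkVerts N (N.head e) p

/-- A simple directed path from `s` to `t`. -/
def IsPath (N : DirPolyNet V E) (s t : V) (p : List E) : Prop :=
  N.IsWalk s t p ∧ (N.walkVerts s p).Nodup

/-- `F` separates the ordered pair `(s,t)`: there is no `s→t` path avoiding `F`. -/
def Separates (N : DirPolyNet V E) (F : Finset E) (s t : V) : Prop :=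
  ¬ ∃ p : List E, N.IsWalk s t p ∧ ∀ e ∈ p, e ∉ F

/-- Total flow on an edge `e`. -/
noncomputable def edgeFlow (N : DirPolyNet V E) {ι : Type} [Fintype ι]
    (f : ι → List E → ℝ) (e : E) : ℝ :=
  ∑ i : ι, ∑ᶠ p ∈ {p : List E | e ∈ p}, f i p

/-- The rate of commodity `i`. -/
noncomputable def rate {ι : Type} (f : ι → List E → ℝ) (i : ι) : ℝ :=
  ∑ᶠ p : List E, f i p

/-- A feasible multicommodity flow for the source-sink pairs `(s i, t i)`. -/
structure IsFlow (N : DirPolyNet V E) {ι : Type} [Fintype ι] (s t : ι → V)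
    (f : ι → List E → ℝ) : Prop where
  nonneg : ∀ i p, 0 ≤ f i p
  supp : ∀ i p, f i p ≠ 0 → N.IsPath (s i) (t i) p
  fin : ∀ i, (Function.support (f i)).Finite
  capM : ∀ v, ∀ S ⊆ N.inE v, ∑ e ∈ S, N.edgeFlow f e ≤ N.rhoM v S
  capP : ∀ v, ∀ S ⊆ N.outE v, ∑ e ∈ S, N.edgeFlow f e ≤ N.rhoP v S

/-- `D(F)`: the total demand of the pairs separated by `F`. -/
noncomputable def sepDemand (N : DirPolyNet V E) {ι : Type} [Fintype ι]
    (s t : ι → V) (D : ι → ℝ) (F : Finset E) : ℝ :=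
  ∑ i : ι, if N.Separates F (s i) (t i) then D i else 0

/-- The value of the maximum throughput multicommodity flow. -/
noncomputable def maxThroughput (N : DirPolyNet V E) {ι : Type} [Fintype ι]
    (s t : ι → V) : ℝ :=
  sSup { r : ℝ | ∃ f : ι → List E → ℝ, N.IsFlow s t f ∧ r = ∑ i : ι, rate f i }

/-- The value of the maximum concurrent multicommodity flow for demands `D`. -/
noncomputable def maxConcurrent (N : DirPolyNet V E) {ι : Type} [Fintype ι]
    (s t : ι → V) (D : ι → ℝ) : ℝ :=
  sSup { lam : ℝ | ∃ f : ι → List E → ℝ, N.IsFlow s t f ∧ ∀ i, rate f i = lam * D i }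

end DirPolyNet

open DirPolyNet

namespace DirPolyNet

theorem sum_map_le_length_mul {E : Type} (w : E → ℕ) (c : ℕ) (p : List E) (h : ∀ e ∈ p, w e ≤ c) :
    (p.map w).sum ≤ c * p.length := by
  have := List.sum_le_card_nsmul (p.map w) c (by simpa using h)
  simpa [mul_comm] using this

theorem sum_map_le_of_sublist {E : Type} (w : E → ℕ) {p q : List E} (h : p.Sublist q) :
    (p.map w).sum ≤ (q.map w).sum :=
  (h.map w).sum_le_sum (by simp)

section Walks

variable {V E : Type} [Fintype V] [Fintype E] [DecidableEq V] [DecidableEq E]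
  (N : DirPolyNet V E)

theorem isWalk_append {x z : V} {p q : List E} :
    N.IsWalk x z (p ++ q) ↔ ∃ y, N.IsWalk x y p ∧ N.IsWalk y z q := by
  induction p generalizing x with
  | nil => simp [IsWalk]
  | cons e p ih =>
    simp only [List.cons_append, IsWalk, ih]
    constructor
    · rintro ⟨h, y, h1, h2⟩
      exact ⟨y, ⟨h, h1⟩, h2⟩
    · rintro ⟨y, ⟨h, h1⟩, h2⟩
      exact ⟨h, y, h1, h2⟩

theorem length_walkVerts (x : V) (p : List E) : (N.walkVerts x p).length = p.length + 1 := by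
  induction p generalizing x with
  | nil => simp [walkVerts]
  | cons e p ih => simp [walkVerts, ih]

theorem mem_walkVerts_start (x : V) (p : List E) : x ∈ N.walkVerts x p := by
  cases p <;> simp [walkVerts]

theorem mem_walkVerts_split {x z v : V} {p : List E} (hp : N.IsWalk x z p)
    (hv : v ∈ N.walkVerts x p) :
    ∃ p₁ p₂, p = p₁ ++ p₂ ∧ N.IsWalk x v p₁ ∧ N.IsWalk v z p₂ := by
  induction p generalizing x with
  | nil =>
    simp only [walkVerts, List.mem_singleton] at hv
    subst hv
    exact ⟨[], [], rfl, rfl, hp⟩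
  | cons e p ih =>
    simp only [walkVerts, List.mem_cons] at hv
    rcases hv with rfl | hv
    · exact ⟨[], e :: p, rfl, rfl, hp⟩
    · obtain ⟨p₁, p₂, rfl, h1, h2⟩ := ih hp.2 hv
      exact ⟨e :: p₁, p₂, rfl, ⟨hp.1, h1⟩, h2⟩

theorem walkVerts_suffix {x y : V} {p q : List E} (hp : N.IsWalk x y p) :
    N.walkVerts y q <:+ N.walkVerts x (p ++ q) := by
  induction p generalizing x with
  | nil =>
    simp only [IsWalk] at hp
    subst hp
    exact List.suffix_rfl
  | cons e p ih =>
    simp only [List.cons_append, walkVerts]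
    exact (ih hp.2).trans (List.suffix_cons _ _)

theorem exists_path_of_isWalk {x y : V} {p : List E} (hp : N.IsWalk x y p) :
    ∃ q, N.IsPath x y q ∧ q.Sublist p := by
  induction p generalizing x with
  | nil => exact ⟨[], ⟨hp, by simp [walkVerts]⟩, List.Sublist.refl _⟩
  | cons e p ih =>
    obtain ⟨q, hq, hs⟩ := ih hp.2
    by_cases hx : x ∈ N.walkVerts (N.head e) q
    · obtain ⟨p₁, p₂, rfl, h1, h2⟩ := N.mem_walkVerts_split hq.1 hx
      exact ⟨p₂, ⟨h2, hq.2.sublist (N.walkVerts_suffix h1).sublist⟩,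
        ((List.sublist_append_right p₁ p₂).trans hs).trans (List.sublist_cons_self _ _)⟩
    · exact ⟨e :: q, ⟨⟨hp.1, hq.1⟩, by simpa [walkVerts, hx] using hq.2⟩, hs.cons_cons _⟩

theorem IsPath.length_lt {N : DirPolyNet V E} {x y : V} {p : List E} (hp : N.IsPath x y p) :
    p.length < Fintype.card V := by
  have := hp.2.length_le_card
  rw [length_walkVerts] at this
  omega

theorem IsPath.suffix {N : DirPolyNet V E} {x y z : V} {p q : List E}
    (h : N.IsPath x z (p ++ q)) (hp : N.IsWalk x y p) (hq : N.IsWalk y z q) : N.IsPath y z q :=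
  ⟨hq, h.2.sublist (N.walkVerts_suffix hp).sublist⟩

theorem IsPath.tail_ne_head {N : DirPolyNet V E} {x y : V} {p : List E} (h : N.IsPath x y p)
    {e : E} (he : e ∈ p) : N.tail e ≠ N.head e := by
  induction p generalizing x with
  | nil => simp at he
  | cons d p ih =>
    have hw := h.1
    have hn := h.2
    simp only [walkVerts, List.nodup_cons] at hn
    rcases List.mem_cons.1 he with rfl | he
    · intro h'
      apply hn.1
      rw [← hw.1, h']
      exact N.mem_walkVerts_start _ _
    · exact ih ⟨hw.2, hn.2⟩ he

/-- `p` is a walk from `x` to `y` using only edges of `H`. -/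
def WalkIn (H : Finset E) (x y : V) (p : List E) : Prop :=
  N.IsWalk x y p ∧ ∀ e ∈ p, e ∈ H

/-- `y` is reachable from `x` along edges of `H`. -/
def Reach (H : Finset E) (x y : V) : Prop := ∃ p, N.WalkIn H x y p

/-- `y` is at distance at most `c` from `x` in the graph `H` with edge lengths `w`. -/
def Near (H : Finset E) (w : E → ℕ) (c : ℕ) (x y : V) : Prop :=
  ∃ p, N.WalkIn H x y p ∧ (p.map w).sum ≤ c

variable {N}

theorem WalkIn.nil (H : Finset E) (x : V) : N.WalkIn H x x [] := ⟨rfl, by simp⟩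

theorem walkIn_cons {H : Finset E} {x y : V} {e : E} {p : List E} :
    N.WalkIn H x y (e :: p) ↔ N.tail e = x ∧ e ∈ H ∧ N.WalkIn H (N.head e) y p := by
  simp only [WalkIn, IsWalk, List.mem_cons, forall_eq_or_imp]
  tauto

theorem walkIn_append {H : Finset E} {x z : V} {p q : List E} :
    N.WalkIn H x z (p ++ q) ↔ ∃ y, N.WalkIn H x y p ∧ N.WalkIn H y z q := by
  simp only [WalkIn, isWalk_append, List.mem_append, or_imp, forall_and]
  constructor
  · rintro ⟨⟨y, h1, h2⟩, h3, h4⟩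
    exact ⟨y, ⟨h1, h3⟩, h2, h4⟩
  · rintro ⟨y, ⟨h1, h3⟩, h2, h4⟩
    exact ⟨⟨y, h1, h2⟩, h3, h4⟩

theorem WalkIn.append {H : Finset E} {x y z : V} {p q : List E} (hp : N.WalkIn H x y p)
    (hq : N.WalkIn H y z q) : N.WalkIn H x z (p ++ q) := walkIn_append.2 ⟨y, hp, hq⟩

theorem WalkIn.mono {H H' : Finset E} {x y : V} {p : List E} (h : N.WalkIn H x y p)
    (hH : H ⊆ H') : N.WalkIn H' x y p := ⟨h.1, fun e he => hH (h.2 e he)⟩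

theorem WalkIn.exists_path {H : Finset E} {x y : V} {p : List E} (h : N.WalkIn H x y p) :
    ∃ q, N.IsPath x y q ∧ N.WalkIn H x y q ∧ q.Sublist p := by
  obtain ⟨q, hq, hs⟩ := N.exists_path_of_isWalk h.1
  exact ⟨q, hq, ⟨hq.1, fun e he => h.2 e (hs.subset he)⟩, hs⟩

theorem Reach.refl (H : Finset E) (x : V) : N.Reach H x x := ⟨[], WalkIn.nil H x⟩

theorem Reach.trans {H : Finset E} {x y z : V} (h : N.Reach H x y) (h' : N.Reach H y z) :
    N.Reach H x z := by
  obtain ⟨p, hp⟩ := h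
  obtain ⟨q, hq⟩ := h'
  exact ⟨p ++ q, hp.append hq⟩

theorem Reach.mono {H H' : Finset E} {x y : V} (h : N.Reach H x y) (hH : H ⊆ H') :
    N.Reach H' x y := by
  obtain ⟨p, hp⟩ := h
  exact ⟨p, hp.mono hH⟩

theorem WalkIn.reach {H : Finset E} {x y : V} {p : List E} (h : N.WalkIn H x y p) :
    N.Reach H x y := ⟨p, h⟩

theorem Near.refl (H : Finset E) (w : E → ℕ) (c : ℕ) (x : V) : N.Near H w c x x :=
  ⟨[], WalkIn.nil H x, by simp⟩

theorem Near.trans {H : Finset E} {w : E → ℕ} {c d : ℕ} {x y z : V} (h : N.Near H w c x y)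
    (h' : N.Near H w d y z) : N.Near H w (c + d) x z := by
  obtain ⟨p, hp, hc⟩ := h
  obtain ⟨q, hq, hd⟩ := h'
  exact ⟨p ++ q, hp.append hq, by simpa using add_le_add hc hd⟩

theorem Near.mono {H : Finset E} {w : E → ℕ} {c d : ℕ} {x y : V} (h : N.Near H w c x y)
    (hcd : c ≤ d) : N.Near H w d x y := by
  obtain ⟨p, hp, hc⟩ := h
  exact ⟨p, hp, hc.trans hcd⟩

variable (N)

/-- The distance from `x` to the set `T` in the graph `H` with edge lengths `w`, truncated at
`R`. -/
noncomputable def distTo (H : Finset E) (w : E → ℕ) (T : V → Prop) (R : ℕ) (x : V) : ℕ :=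
  sInf {k | k = R ∨ ∃ z p, T z ∧ N.WalkIn H x z p ∧ k = (p.map w).sum}

variable {N}

theorem distTo_le (H : Finset E) (w : E → ℕ) (T : V → Prop) (R : ℕ) (x : V) :
    N.distTo H w T R x ≤ R := Nat.sInf_le (Or.inl rfl)

theorem distTo_le_sum {H : Finset E} {w : E → ℕ} {T : V → Prop} (R : ℕ) {x z : V} {p : List E}
    (hz : T z) (hp : N.WalkIn H x z p) : N.distTo H w T R x ≤ (p.map w).sum :=
  Nat.sInf_le (Or.inr ⟨z, p, hz, hp, rfl⟩)

theorem distTo_eq_zero {H : Finset E} {w : E → ℕ} {T : V → Prop} (R : ℕ) {z : V}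
    (hz : T z) : N.distTo H w T R z = 0 := by
  have := distTo_le_sum (w := w) R hz (WalkIn.nil (N := N) H z)
  simpa using this

theorem distTo_cases (H : Finset E) (w : E → ℕ) (T : V → Prop) (R : ℕ) (x : V) :
    N.distTo H w T R x = R ∨
      ∃ z p, T z ∧ N.WalkIn H x z p ∧ N.distTo H w T R x = (p.map w).sum :=
  Nat.sInf_mem (s := {k | k = R ∨ ∃ z p, T z ∧ N.WalkIn H x z p ∧ k = (p.map w).sum})
    ⟨R, Or.inl rfl⟩

theorem distTo_tail_le {H : Finset E} {w : E → ℕ} {T : V → Prop} {R : ℕ} {e : E} (he : e ∈ H) :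
    N.distTo H w T R (N.tail e) ≤ w e + N.distTo H w T R (N.head e) := by
  rcases distTo_cases (N := N) H w T R (N.head e) with h | ⟨z, p, hz, hp, h⟩
  · rw [h]
    exact (distTo_le ..).trans (Nat.le_add_left _ _)
  · rw [h]
    have := distTo_le_sum (w := w) R hz (walkIn_cons.2 ⟨rfl, he, hp⟩)
    simpa using this

end Walks

end DirPolyNet

namespace DirPolyNet

section Costs

variable {V E : Type} [Fintype V] [Fintype E] [DecidableEq V] [DecidableEq E]
  (N : DirPolyNet V E)

theorem rhoP_union_le (v : V) {A B : Finset E} (hA : A ⊆ N.outE v) (hB : B ⊆ N.outE v) :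
    N.rhoP v (A ∪ B) ≤ N.rhoP v A + N.rhoP v B := by
  have h := N.rhoP_submod v A B hA hB
  have h' := N.rhoP_nonneg v (A ∩ B) (Finset.inter_subset_left.trans hA)
  linarith

theorem rhoM_union_le (v : V) {A B : Finset E} (hA : A ⊆ N.inE v) (hB : B ⊆ N.inE v) :
    N.rhoM v (A ∪ B) ≤ N.rhoM v A + N.rhoM v B := by
  have h := N.rhoM_submod v A B hA hB
  have h' := N.rhoM_nonneg v (A ∩ B) (Finset.inter_subset_left.trans hA)
  linarith

/-- The cost of cutting the edges of `A` at their tails and the edges of `B` at their heads. -/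
noncomputable def splitCost (A B : Finset E) : ℝ :=
  ∑ v, (N.rhoP v (N.outE v ∩ A) + N.rhoM v (N.inE v ∩ B))

theorem splitCost_nonneg (A B : Finset E) : 0 ≤ N.splitCost A B :=
  Finset.sum_nonneg fun v _ => add_nonneg (N.rhoP_nonneg v _ Finset.inter_subset_left)
    (N.rhoM_nonneg v _ Finset.inter_subset_left)

/-- `F` is a loopless edge set which can be cut at cost at most `c`. -/
def Cheap (F : Finset E) (c : ℝ) : Prop :=
  (∀ e ∈ F, N.tail e ≠ N.head e) ∧ ∃ A B : Finset E, F ⊆ A ∪ B ∧ N.splitCost A B ≤ c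

variable {N}

theorem Cheap.empty : N.Cheap ∅ 0 :=
  ⟨by simp, ∅, ∅, by simp, by simp [splitCost, rhoP_empty, rhoM_empty]⟩

theorem Cheap.mono {F : Finset E} {c d : ℝ} (h : N.Cheap F c) (hcd : c ≤ d) : N.Cheap F d := by
  obtain ⟨h1, A, B, h2, h3⟩ := h
  exact ⟨h1, A, B, h2, h3.trans hcd⟩

theorem Cheap.nonneg {F : Finset E} {c : ℝ} (h : N.Cheap F c) : 0 ≤ c := by
  obtain ⟨h1, A, B, h2, h3⟩ := h
  exact (N.splitCost_nonneg A B).trans h3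

theorem Cheap.union {F F' : Finset E} {c d : ℝ} (h : N.Cheap F c) (h' : N.Cheap F' d) :
    N.Cheap (F ∪ F') (c + d) := by
  obtain ⟨h1, A, B, h2, h3⟩ := h
  obtain ⟨h1', A', B', h2', h3'⟩ := h'
  refine ⟨fun e he => ?_, A ∪ A', B ∪ B', ?_, ?_⟩
  · rcases Finset.mem_union.1 he with he | he
    · exact h1 e he
    · exact h1' e he
  · intro e he
    have h2e := @h2 e
    have h2e' := @h2' e
    simp only [Finset.mem_union] at *
    tauto
  · refine le_trans ?_ (add_le_add h3 h3')
    unfold splitCost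
    rw [← Finset.sum_add_distrib]
    refine Finset.sum_le_sum fun v _ => ?_
    rw [Finset.inter_union_distrib_left, Finset.inter_union_distrib_left]
    have := N.rhoP_union_le v (A := N.outE v ∩ A) (B := N.outE v ∩ A')
      Finset.inter_subset_left Finset.inter_subset_left
    have := N.rhoM_union_le v (A := N.inE v ∩ B) (B := N.inE v ∩ B')
      Finset.inter_subset_left Finset.inter_subset_left
    linarith

theorem Cheap.cutCost_le {F : Finset E} {c : ℝ} (h : N.Cheap F c) : N.cutCost F ≤ c := by
  obtain ⟨h1, A, B, h2, h3⟩ := h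
  refine le_trans (csInf_le ⟨0, ?_⟩
    ⟨fun e => if e ∈ A then N.tail e else N.head e, ?_, rfl⟩) (le_trans ?_ h3)
  · rintro _ ⟨g, -, rfl⟩
    exact Finset.sum_nonneg fun v _ => add_nonneg
      (N.rhoM_nonneg v _ ((Finset.filter_subset _ _).trans Finset.inter_subset_left))
      (N.rhoP_nonneg v _ ((Finset.filter_subset _ _).trans Finset.inter_subset_left))
  · intro e _
    by_cases he : e ∈ A <;> simp [he]
  · refine Finset.sum_le_sum fun v _ => ?_
    rw [add_comm]
    refine add_le_add (N.rhoP_mono v _ _ ?_ Finset.inter_subset_left)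
      (N.rhoM_mono v _ _ ?_ Finset.inter_subset_left)
    · intro e he
      simp only [Finset.mem_filter, Finset.mem_inter, outE, Finset.mem_univ, true_and] at he ⊢
      refine ⟨he.1.1, ?_⟩
      by_contra hA
      rw [if_neg hA] at he
      exact h1 e he.1.2 (he.1.1.trans he.2.symm)
    · intro e he
      simp only [Finset.mem_filter, Finset.mem_inter, inE, Finset.mem_univ, true_and] at he ⊢
      refine ⟨he.1.1, ?_⟩
      by_contra hB
      have hA : e ∈ A := (Finset.mem_union.1 (h2 he.1.2)).resolve_right hB
      rw [if_pos hA] at he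
      exact h1 e he.1.2 (he.2.trans he.1.1.symm)

variable (N)

/-- Integral tail lengths `α` and head lengths `β`, at most `K` on the loopless edge set `E₀`,
whose level sets at a vertex `v` are cheap in terms of `cP v` and `cM v`. -/
structure IsLeveled (E₀ : Finset E) (α β : E → ℕ) (K : ℕ) (S : ℝ) (cP cM : V → ℝ) : Prop where
  loopless : ∀ e ∈ E₀, N.tail e ≠ N.head e
  le_tail : ∀ e ∈ E₀, α e ≤ K
  le_head : ∀ e ∈ E₀, β e ≤ K
  S_pos : 0 < S
  cP_nonneg : ∀ v, 0 ≤ cP v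
  cM_nonneg : ∀ v, 0 ≤ cM v
  level_tail : ∀ v (j : ℕ), ∀ T ⊆ N.outE v ∩ E₀, (∀ e ∈ T, j ≤ α e) → j * N.rhoP v T ≤ S * cP v
  level_head : ∀ v (j : ℕ), ∀ T ⊆ N.inE v ∩ E₀, (∀ e ∈ T, j ≤ β e) → j * N.rhoM v T ≤ S * cM v

/-- The edges of `H` crossing level `r` of `lam` downwards. -/
def levelCut (H : Finset E) (lam : V → ℕ) (r : ℕ) : Finset E :=
  H.filter fun e => lam (N.head e) ≤ r ∧ r < lam (N.tail e)

variable {N}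

theorem WalkIn.lt_of_levelCut {H : Finset E} {lam : V → ℕ} {r : ℕ} {x y : V} {p : List E}
    (h : N.WalkIn (H \ N.levelCut H lam r) x y p) (hx : r < lam x) : r < lam y := by
  induction p generalizing x with
  | nil => rw [← h.1]; exact hx
  | cons e p ih =>
    obtain ⟨rfl, he, hp⟩ := walkIn_cons.1 h
    refine ih hp ?_
    by_contra hle
    rw [Finset.mem_sdiff] at he
    exact he.2 (Finset.mem_filter.2 ⟨he.1, not_lt.1 hle, hx⟩)

theorem sum_le_mul_harmonic (R K : ℕ) {c : ℝ} (hc : 0 ≤ c) (f : ℕ → ℝ) (P : ℕ → Prop)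
    (φ : ℕ → ℕ) (hφ : ∀ r, P r → 1 ≤ φ r ∧ φ r ≤ K)
    (hinj : ∀ r r', P r → P r' → φ r = φ r' → r = r')
    (h0 : ∀ r, ¬ P r → f r ≤ 0) (h1 : ∀ r, P r → φ r * f r ≤ c) :
    ∑ r ∈ range R, f r ≤ c * (harmonic K : ℝ) := by
  calc ∑ r ∈ range R, f r ≤ ∑ r ∈ range R, if P r then c * ((φ r : ℕ) : ℝ)⁻¹ else 0 := by
        refine Finset.sum_le_sum fun r _ => ?_
        by_cases hr : P r
        · rw [if_pos hr, ← div_eq_mul_inv, le_div_iff₀ (by exact_mod_cast (hφ r hr).1)]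
          linarith [h1 r hr, mul_comm (f r) (φ r)]
        · rw [if_neg hr]; exact h0 r hr
    _ = ∑ r ∈ (range R).filter P, c * ((φ r : ℕ) : ℝ)⁻¹ := by rw [Finset.sum_filter]
    _ = ∑ j ∈ ((range R).filter P).image φ, c * (j : ℝ)⁻¹ := by
        rw [Finset.sum_image]
        intro r hr r' hr' h
        simp only [Finset.coe_filter, Set.mem_ofPred_eq] at hr hr'
        exact hinj r r' hr.2 hr'.2 h
    _ ≤ ∑ j ∈ Icc 1 K, c * (j : ℝ)⁻¹ := by
        refine Finset.sum_le_sum_of_subset_of_nonneg ?_ fun _ _ _ => by positivity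
        intro j hj
        obtain ⟨r, hr, rfl⟩ := Finset.mem_image.1 hj
        exact Finset.mem_Icc.2 (hφ r (Finset.mem_filter.1 hr).2)
    _ = c * (harmonic K : ℝ) := by
        rw [harmonic_eq_sum_Icc, ← Finset.mul_sum]
        push_cast
        rfl

/-- The average cost of the level cuts of a function `lam` that decreases along an edge by at most
the lengths of the half-edges at vertices of `G`. -/
theorem IsLeveled.exists_levelCut_cost {E₀ : Finset E} {α β : E → ℕ} {K : ℕ} {S : ℝ}
    {cP cM : V → ℝ} (h : N.IsLeveled E₀ α β K S cP cM) {H : Finset E} (hH : H ⊆ E₀)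
    (lam : V → ℕ) (G : Finset V)
    (hlam : ∀ e ∈ H, lam (N.tail e) ≤ ((if N.tail e ∈ G then α e else 0) +
      (if N.head e ∈ G then β e else 0)) + lam (N.head e)) (R : ℕ) :
    ∃ cost : ℕ → ℝ, (∀ r, N.Cheap (N.levelCut H lam r) (cost r)) ∧
      ∑ r ∈ range R, cost r ≤ S * (harmonic K : ℝ) * ∑ v ∈ G, (cP v + cM v) := by
  set A : ℕ → Finset E := fun r => (N.levelCut H lam r).filter fun e =>
    N.tail e ∈ G ∧ lam (N.tail e) - r ≤ α e with hA
  set B : ℕ → Finset E := fun r => (N.levelCut H lam r).filter fun e =>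
    N.head e ∈ G ∧ r - lam (N.head e) + 1 ≤ β e with hB
  have memA : ∀ r e, e ∈ A r → e ∈ E₀ ∧ N.tail e ∈ G ∧ lam (N.tail e) - r ≤ α e ∧
      r < lam (N.tail e) := by
    intro r e he
    simp only [hA, levelCut, Finset.mem_filter] at he
    exact ⟨hH he.1.1, he.2.1, he.2.2, he.1.2.2⟩
  have memB : ∀ r e, e ∈ B r → e ∈ E₀ ∧ N.head e ∈ G ∧ r - lam (N.head e) + 1 ≤ β e ∧
      lam (N.head e) ≤ r := by
    intro r e he
    simp only [hB, levelCut, Finset.mem_filter] at he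
    exact ⟨hH he.1.1, he.2.1, he.2.2, he.1.2.1⟩
  have hcost : ∀ v, ∑ r ∈ range R, (N.rhoP v (N.outE v ∩ A r) + N.rhoM v (N.inE v ∩ B r)) ≤
      if v ∈ G then S * (harmonic K : ℝ) * (cP v + cM v) else 0 := by
    intro v
    split_ifs with hv
    · rw [Finset.sum_add_distrib]
      have hSP := mul_nonneg h.S_pos.le (h.cP_nonneg v)
      have hSM := mul_nonneg h.S_pos.le (h.cM_nonneg v)
      have e1 : ∑ r ∈ range R, N.rhoP v (N.outE v ∩ A r) ≤ S * cP v * (harmonic K : ℝ) := by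
        refine sum_le_mul_harmonic R K hSP _ (fun r => (N.outE v ∩ A r).Nonempty)
          (fun r => lam v - r) ?_ ?_ ?_ ?_
        · rintro r ⟨e, he⟩
          simp only [outE, Finset.mem_inter, Finset.mem_filter, Finset.mem_univ, true_and] at he
          obtain ⟨h1, -, h3, h4⟩ := memA r e he.2
          rw [he.1] at h3 h4
          have := h.le_tail e h1
          omega
        · rintro r r' ⟨e, he⟩ ⟨e', he'⟩ hrr
          simp only [outE, Finset.mem_inter, Finset.mem_filter, Finset.mem_univ, true_and] at he he'
          obtain ⟨-, -, -, h4⟩ := memA r e he.2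
          obtain ⟨-, -, -, h4'⟩ := memA r' e' he'.2
          rw [he.1] at h4
          rw [he'.1] at h4'
          omega
        · intro r hr
          rw [Finset.not_nonempty_iff_eq_empty.1 hr, N.rhoP_empty]
        · intro r _
          refine h.level_tail v _ _ ?_ ?_
          · exact fun e he => Finset.mem_inter.2 ⟨(Finset.mem_inter.1 he).1,
              (memA r e (Finset.mem_inter.1 he).2).1⟩
          · intro e he
            simp only [outE, Finset.mem_inter, Finset.mem_filter, Finset.mem_univ, true_and] at he
            rw [← he.1]
            exact (memA r e he.2).2.2.1
      have e2 : ∑ r ∈ range R, N.rhoM v (N.inE v ∩ B r) ≤ S * cM v * (harmonic K : ℝ) := by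
        refine sum_le_mul_harmonic R K hSM _ (fun r => (N.inE v ∩ B r).Nonempty)
          (fun r => r - lam v + 1) ?_ ?_ ?_ ?_
        · rintro r ⟨e, he⟩
          simp only [inE, Finset.mem_inter, Finset.mem_filter, Finset.mem_univ, true_and] at he
          obtain ⟨h1, -, h3, h4⟩ := memB r e he.2
          rw [he.1] at h3 h4
          have := h.le_head e h1
          omega
        · rintro r r' ⟨e, he⟩ ⟨e', he'⟩ hrr
          simp only [inE, Finset.mem_inter, Finset.mem_filter, Finset.mem_univ, true_and] at he he'
          obtain ⟨-, -, -, h4⟩ := memB r e he.2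
          obtain ⟨-, -, -, h4'⟩ := memB r' e' he'.2
          rw [he.1] at h4
          rw [he'.1] at h4'
          omega
        · intro r hr
          rw [Finset.not_nonempty_iff_eq_empty.1 hr, N.rhoM_empty]
        · intro r _
          refine h.level_head v _ _ ?_ ?_
          · exact fun e he => Finset.mem_inter.2 ⟨(Finset.mem_inter.1 he).1,
              (memB r e (Finset.mem_inter.1 he).2).1⟩
          · intro e he
            simp only [inE, Finset.mem_inter, Finset.mem_filter, Finset.mem_univ, true_and] at he
            rw [← he.1]
            exact (memB r e he.2).2.2.1
      linarith
    · refine (Finset.sum_eq_zero fun r _ => ?_).le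
      have e1 : N.outE v ∩ A r = ∅ := by
        refine Finset.eq_empty_of_forall_notMem fun e he => hv ?_
        simp only [outE, Finset.mem_inter, Finset.mem_filter, Finset.mem_univ, true_and] at he
        rw [← he.1]
        exact (memA r e he.2).2.1
      have e2 : N.inE v ∩ B r = ∅ := by
        refine Finset.eq_empty_of_forall_notMem fun e he => hv ?_
        simp only [inE, Finset.mem_inter, Finset.mem_filter, Finset.mem_univ, true_and] at he
        rw [← he.1]
        exact (memB r e he.2).2.1
      rw [e1, e2, N.rhoP_empty, N.rhoM_empty, add_zero]
  refine ⟨fun r => N.splitCost (A r) (B r), fun r => ⟨fun e he => ?_, A r, B r, ?_, le_rfl⟩, ?_⟩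
  · exact h.loopless e (hH (Finset.mem_filter.1 he).1)
  · intro e he
    have hm := he
    simp only [levelCut, Finset.mem_filter] at he
    have := hlam e he.1
    simp only [hA, hB, Finset.mem_union, Finset.mem_filter, hm, true_and]
    by_cases h1 : N.tail e ∈ G <;> by_cases h2 : N.head e ∈ G <;> simp only [h1, h2] at this ⊢ <;>
      simp only [if_true, if_false, true_and, false_and, or_false, false_or] at this ⊢ <;> omega
  · unfold splitCost
    rw [Finset.sum_comm]
    refine (Finset.sum_le_sum fun v _ => hcost v).trans ?_
    rw [← Finset.sum_filter, Finset.mul_sum]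
    simp

end Costs

end DirPolyNet

namespace DirPolyNet

section PeakLemmas

variable {V E : Type} [Fintype V] [Fintype E] [DecidableEq V] [DecidableEq E]
  (N : DirPolyNet V E)

/-- The maximum of `lam` over the vertices of the walk `p` starting at `x`. -/
def peak (lam : V → ℕ) : V → List E → ℕ
  | x, [] => lam x
  | x, e :: p => max (lam x) (peak lam (N.head e) p)

variable {N} {lam : V → ℕ}

theorem le_peak (x : V) (p : List E) : lam x ≤ N.peak lam x p := by
  cases p <;> simp [peak]

theorem le_peak_of_mem {x v : V} {p : List E} (hv : v ∈ N.walkVerts x p) :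
    lam v ≤ N.peak lam x p := by
  induction p generalizing x with
  | nil =>
    simp only [walkVerts, List.mem_singleton] at hv
    subst hv
    exact le_rfl
  | cons e p ih =>
    simp only [walkVerts, List.mem_cons] at hv
    rcases hv with rfl | hv
    · exact le_peak _ _
    · exact (ih hv).trans (le_max_right _ _)

theorem WalkIn.reach_of_mem {H : Finset E} {x z v : V} {p : List E} (hp : N.WalkIn H x z p)
    (hv : v ∈ N.walkVerts x p) : N.Reach H x v := by
  obtain ⟨p₁, p₂, rfl, h1, h2⟩ := N.mem_walkVerts_split hp.1 hv
  exact ⟨p₁, h1, fun e he => hp.2 e (List.mem_append_left _ he)⟩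

variable (N) in
/-- The number of vertices of a walk satisfying a predicate. -/
noncomputable def vertCount (P : V → Prop) (x : V) (p : List E) : ℕ :=
  (N.walkVerts x p).countP (fun v => decide (P v))

theorem vertCount_le_card {P : V → Prop} {x : V} {p : List E} (hp : (N.walkVerts x p).Nodup)
    (T : Finset V) (hT : ∀ v ∈ N.walkVerts x p, P v → v ∈ T) : N.vertCount P x p ≤ T.card := by
  unfold vertCount
  rw [List.countP_eq_length_filter, ← List.toFinset_card_of_nodup (hp.filter _)]
  refine Finset.card_le_card fun v hv => ?_
  simp only [List.mem_toFinset, List.mem_filter, decide_eq_true_eq] at hv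
  exact hT v hv.1 hv.2

theorem exists_suffix_peak {H : Finset E} {d : ℕ}
    (hd : ∀ e ∈ H, lam (N.tail e) ≤ d + lam (N.head e)) {x z : V} {p : List E}
    (hp : N.WalkIn H x z p) (hz : lam z = 0) {a : ℕ} (ha : a ≤ N.peak lam x p) :
    ∃ y p₁ p₂, p = p₁ ++ p₂ ∧ N.WalkIn H x y p₁ ∧ N.WalkIn H y z p₂ ∧
      N.peak lam y p₂ ≤ a ∧ a ≤ N.peak lam y p₂ + d := by
  induction p generalizing x with
  | nil =>
    refine ⟨x, [], [], rfl, WalkIn.nil H x, hp, ?_, ha.trans (Nat.le_add_right _ _)⟩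
    have : x = z := hp.1
    simp [peak, this, hz]
  | cons e p ih =>
    obtain ⟨rfl, he, hp'⟩ := walkIn_cons.1 hp
    by_cases h1 : N.peak lam (N.tail e) (e :: p) ≤ a
    · exact ⟨_, [], e :: p, rfl, WalkIn.nil _ _, hp, h1, ha.trans (Nat.le_add_right _ _)⟩
    by_cases h2 : a ≤ N.peak lam (N.head e) p
    · obtain ⟨y, p₁, p₂, rfl, k1, k2, k3⟩ := ih hp' h2
      exact ⟨y, e :: p₁, p₂, rfl, walkIn_cons.2 ⟨rfl, he, k1⟩, k2, k3⟩
    · refine ⟨N.head e, [e], p, rfl, walkIn_cons.2 ⟨rfl, he, WalkIn.nil _ _⟩, hp', by omega, ?_⟩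
      have h3 := hd e he
      have h4 := le_peak (N := N) (lam := lam) (N.head e) p
      simp only [peak] at h1
      omega

/-- A walk all of whose vertices of height at most `a` in `A` are few must leave `A` without
dropping much below the level `a`. -/
theorem exists_suffix_notMem {H : Finset E} {d : ℕ}
    (hd : ∀ e ∈ H, lam (N.tail e) ≤ d + lam (N.head e)) (A : Finset V) (a : ℕ) {x z : V}
    {p : List E} (hp : N.WalkIn H x z p) (hz : lam z = 0) :
    let t := d * (N.vertCount (fun v => v ∈ A ∧ lam v ≤ a) x p +
      if N.peak lam x p ≤ a then 0 else 1)
    (min (N.peak lam x p) a ≤ t) ∨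
      ∃ y p₁ p₂, p = p₁ ++ p₂ ∧ N.WalkIn H x y p₁ ∧ N.WalkIn H y z p₂ ∧ y ∉ A ∧
        min (N.peak lam x p) a ≤ N.peak lam y p₂ + t := by
  induction p generalizing x with
  | nil =>
    have : x = z := hp.1
    left
    simp [peak, this, hz]
  | cons e p ih =>
    obtain ⟨rfl, he, hp'⟩ := walkIn_cons.1 hp
    by_cases hA : N.tail e ∈ A
    swap
    · right
      exact ⟨_, [], e :: p, rfl, WalkIn.nil _ _, hp, hA,
        (min_le_left _ _).trans (Nat.le_add_right _ _)⟩
    have key : min (N.peak lam (N.tail e) (e :: p)) a +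
        d * (N.vertCount (fun v => v ∈ A ∧ lam v ≤ a) (N.head e) p +
          if N.peak lam (N.head e) p ≤ a then 0 else 1) ≤
        min (N.peak lam (N.head e) p) a +
        d * (N.vertCount (fun v => v ∈ A ∧ lam v ≤ a) (N.tail e) (e :: p) +
          if N.peak lam (N.tail e) (e :: p) ≤ a then 0 else 1) := by
      have h3 := hd e he
      have h4 := le_peak (N := N) (lam := lam) (N.head e) p
      have hc : N.vertCount (fun v => v ∈ A ∧ lam v ≤ a) (N.tail e) (e :: p) =
          N.vertCount (fun v => v ∈ A ∧ lam v ≤ a) (N.head e) p +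
            if lam (N.tail e) ≤ a then 1 else 0 := by
        simp [vertCount, walkVerts, List.countP_cons, hA]
      rw [hc]
      simp only [peak]
      by_cases h5 : lam (N.tail e) ≤ a <;> by_cases h6 : N.peak lam (N.head e) p ≤ a <;>
        simp only [h5, h6, max_le_iff, and_true, and_self, if_true, if_false, mul_add, mul_one,
          mul_zero, and_false] <;> omega
    rcases ih hp' with h | ⟨y, p₁, p₂, rfl, k1, k2, k3, k4⟩
    · left
      omega
    · right
      refine ⟨y, e :: p₁, p₂, rfl, walkIn_cons.2 ⟨rfl, he, k1⟩, k2, k3, ?_⟩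
      omega

variable (N) in
/-- The hypotheses under which replacing the lengths `len` by `len'` cannot shorten a path much:
the two agree on edges without `bad` endpoint, and no bad vertex of height at least `h₀` has `k`
vertices of `A v` at depth `h` below it or `A₁` reachable vertices at depth `h₀` below it. -/
structure IsThin (H : Finset E) (lam : V → ℕ) (len len' : E → ℕ) (bad : V → Prop)
    (A R : V → Finset V) (d h h₀ k A₁ A₂ κ : ℕ) : Prop where
  lip : ∀ e ∈ H, lam (N.tail e) ≤ len e + lam (N.head e)
  len_le : ∀ e ∈ H, len e ≤ d
  len_good : ∀ e ∈ H, ¬ bad (N.tail e) → ¬ bad (N.head e) → len e ≤ len' e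
  self_mem : ∀ v, v ∈ A v
  mem_R : ∀ v x, N.Reach H v x → x ∈ R v
  card_R : ∀ x y, N.Reach H x y → (R y).card ≤ (R x).card
  card_A_lt : ∀ v, bad v → h₀ ≤ lam v → ((A v).filter fun x => lam x ≤ lam v - h).card < k
  card_R_lt : ∀ v, bad v → h₀ ≤ lam v → ((R v).filter fun x => lam x ≤ lam v - h₀).card < A₁
  leave : ∀ v y p, bad v → h₀ ≤ lam v → N.WalkIn H v y p → y ∉ A v →
    2 * (R y).card + A₂ ≤ 2 * (R v).card ∨ κ < p.length

namespace IsThin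

variable {H : Finset E} {len len' : E → ℕ} {bad : V → Prop}
    {A R : V → Finset V} {d h h₀ k A₁ A₂ κ : ℕ}

theorem lip' (hT : N.IsThin H lam len len' bad A R d h h₀ k A₁ A₂ κ) :
    ∀ e ∈ H, lam (N.tail e) ≤ d + lam (N.head e) := fun e he =>
  (hT.lip e he).trans (Nat.add_le_add_right (hT.len_le e he) _)

theorem exists_leave (hT : N.IsThin H lam len len' bad A R d h h₀ k A₁ A₂ κ) {v z : V}
    {p : List E} (hp : N.WalkIn H v z p) (hn : (N.walkVerts v p).Nodup) (hz : lam z = 0)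
    (hv : bad v) (hlv : h₀ ≤ lam v) :
    lam v ≤ h + d * k ∨ ∃ y p₁ p₂, p = p₁ ++ p₂ ∧ p₁ ≠ [] ∧ N.WalkIn H v y p₁ ∧
      N.WalkIn H y z p₂ ∧ lam v ≤ N.peak lam y p₂ + (h + d * k) ∧
      (2 * (R y).card + A₂ ≤ 2 * (R v).card ∨ κ < p₁.length) := by
  have hc : N.vertCount (fun x => x ∈ A v ∧ lam x ≤ lam v - h) v p + 1 ≤ k := by
    refine (vertCount_le_card hn _ ?_).trans_lt (hT.card_A_lt v hv hlv)
    intro x _ hx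
    exact Finset.mem_filter.2 hx
  have hpk := le_peak (N := N) (lam := lam) v p
  have ht : d * (N.vertCount (fun x => x ∈ A v ∧ lam x ≤ lam v - h) v p +
      if N.peak lam v p ≤ lam v - h then 0 else 1) ≤ d * k := by
    refine Nat.mul_le_mul_left d (le_trans ?_ hc)
    split_ifs <;> omega
  rcases exists_suffix_notMem hT.lip' (A v) (lam v - h) hp hz with h1 |
    ⟨y, p₁, p₂, h1, h2, h3, h4, h5⟩
  · left
    omega
  · right
    refine ⟨y, p₁, p₂, h1, ?_, h2, h3, ?_, hT.leave v y p₁ hv hlv h2 h4⟩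
    · rintro rfl
      have : v = y := h2.1
      exact h4 (this ▸ hT.self_mem v)
    · omega

theorem peak_le (hT : N.IsThin H lam len len' bad A R d h h₀ k A₁ A₂ κ) (n : ℕ) {x z : V}
    {p : List E} (hpn : p.length ≤ n) (hp : N.WalkIn H x z p) (hn : (N.walkVerts x p).Nodup)
    (hz : lam z = 0) :
    ∃ i j, A₂ * i ≤ 2 * (R x).card ∧ κ * j ≤ p.length ∧
      N.peak lam x p ≤ (p.map len').sum + (h + d * (k + 1)) * (1 + i + j) + h₀ + d := by
  induction n generalizing x p with
  | zero =>
    have : p = [] := List.length_eq_zero_iff.1 (Nat.le_zero.1 hpn)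
    subst this
    have : x = z := hp.1
    exact ⟨0, 0, by simp, by simp, by simp [peak, this, hz]⟩
  | succ n ih =>
    cases p with
    | nil =>
      have : x = z := hp.1
      exact ⟨0, 0, by simp, by simp, by simp [peak, this, hz]⟩
    | cons e p =>
      obtain ⟨rfl, he, hp'⟩ := walkIn_cons.1 hp
      have hn' : (N.walkVerts (N.head e) p).Nodup := by
        simp only [walkVerts, List.nodup_cons] at hn
        exact hn.2
      have hcard := hT.card_R _ _ (walkIn_cons.2 ⟨rfl, he, WalkIn.nil H (N.head e)⟩).reach
      have hlen : p.length ≤ n := by simpa using hpn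
      have hdrop := le_peak (N := N) (lam := lam) (N.head e) p
      have hd := hT.lip' e he
      have leave : ∀ v q r, r ++ q = e :: p → N.WalkIn H (N.tail e) v r → N.WalkIn H v z q →
          bad v → h₀ ≤ lam v → (R v).card ≤ (R (N.tail e)).card → lam (N.tail e) ≤ lam v + d →
          ∃ i j, A₂ * i ≤ 2 * (R (N.tail e)).card ∧ κ * j ≤ (e :: p).length ∧
            lam (N.tail e) ≤ ((e :: p).map len').sum + (h + d * (k + 1)) * (1 + i + j) + h₀ + d := by
        intro v q r hrq hr hq hv hlv hRv hl
        have hnq : (N.walkVerts v q).Nodup := by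
          rw [← hrq] at hn
          exact hn.sublist (N.walkVerts_suffix hr.1).sublist
        rcases hT.exists_leave hq hnq hz hv hlv with h1 | ⟨y, p₁, p₂, rfl, h2, h3, h4, h5, h6⟩
        · exact ⟨0, 0, by simp, by simp, by simp only [mul_add]; omega⟩
        · have hn2 : (N.walkVerts y p₂).Nodup := hnq.sublist (N.walkVerts_suffix h3.1).sublist
          have hl1 : (e :: p).length = r.length + (p₁.length + p₂.length) := by
            rw [← hrq]; simp
          have hp1 : 0 < p₁.length := List.length_pos_iff.2 h2
          have hs : (p₂.map len').sum ≤ ((e :: p).map len').sum := by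
            rw [← hrq]; simp; omega
          obtain ⟨i, j, k1, k2, k3⟩ := ih (by omega) h4 hn2
          have hRy := hT.card_R _ _ h3.reach
          rcases h6 with h6 | h6
          · refine ⟨i + 1, j, ?_, ?_, ?_⟩
            · rw [mul_add]; omega
            · omega
            · simp only [mul_add] at k3 ⊢; omega
          · refine ⟨i, j + 1, by omega, ?_, ?_⟩
            · rw [mul_add]; omega
            · simp only [mul_add] at k3 ⊢; omega
      by_cases h1 : N.peak lam (N.tail e) (e :: p) ≤ N.peak lam (N.head e) p
      · obtain ⟨i, j, k1, k2, k3⟩ := ih hlen hp' hn'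
        exact ⟨i, j, by omega, by simp; omega, by simp only [List.map_cons, List.sum_cons]; omega⟩
      have h2 : N.peak lam (N.tail e) (e :: p) = lam (N.tail e) := by
        simp only [peak] at h1 ⊢; omega
      rw [h2] at h1 ⊢
      by_cases hb : bad (N.tail e)
      · by_cases hl : h₀ ≤ lam (N.tail e)
        · exact leave _ (e :: p) [] rfl (WalkIn.nil _ _) hp hb hl le_rfl (by omega)
        · exact ⟨0, 0, by simp, by simp, by omega⟩
      by_cases hb' : bad (N.head e)
      · by_cases hl : h₀ ≤ lam (N.head e)
        · exact leave _ p [e] rfl (walkIn_cons.2 ⟨rfl, he, WalkIn.nil _ _⟩) hp' hb' hl hcard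
            (by omega)
        · exact ⟨0, 0, by simp, by simp, by omega⟩
      obtain ⟨i, j, k1, k2, k3⟩ := ih hlen hp' hn'
      have h3 := hT.lip e he
      have h4 := hT.len_good e he hb hb'
      exact ⟨i, j, by omega, by simp; omega, by simp only [List.map_cons, List.sum_cons]; omega⟩

theorem peak_le_of_card (hT : N.IsThin H lam len len' bad A R d h h₀ k A₁ A₂ κ) {n : ℕ}
    (hRn : ∀ x, (R x).card ≤ n) {x z : V} {p : List E} (hp : N.WalkIn H x z p)
    (hn : (N.walkVerts x p).Nodup) (hz : lam z = 0) :
    ∃ i j, A₂ * i ≤ 2 * n ∧ κ * j ≤ A₁ ∧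
      N.peak lam x p ≤
        (p.map len').sum + (h + d * (k + 1)) * (1 + i + j) + 2 * h₀ + 3 * d := by
  induction p generalizing x with
  | nil =>
    have : x = z := hp.1
    exact ⟨0, 0, by simp, by simp, by simp [peak, this, hz]⟩
  | cons e p ih =>
    obtain ⟨rfl, he, hp'⟩ := walkIn_cons.1 hp
    have hn' : (N.walkVerts (N.head e) p).Nodup := by
      simp only [walkVerts, List.nodup_cons] at hn
      exact hn.2
    have hdrop := le_peak (N := N) (lam := lam) (N.head e) p
    have hd := hT.lip' e he
    have leave : ∀ v q r, r ++ q = e :: p → N.WalkIn H (N.tail e) v r → N.WalkIn H v z q →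
        bad v → h₀ ≤ lam v → lam (N.tail e) ≤ lam v + d →
        ∃ i j, A₂ * i ≤ 2 * n ∧ κ * j ≤ A₁ ∧ lam (N.tail e) ≤
          ((e :: p).map len').sum + (h + d * (k + 1)) * (1 + i + j) + 2 * h₀ + 3 * d := by
      intro v q r hrq hr hq hv hlv hl
      have hnq : (N.walkVerts v q).Nodup := by
        rw [← hrq] at hn
        exact hn.sublist (N.walkVerts_suffix hr.1).sublist
      obtain ⟨y, p₁, p₂, rfl, h3, h4, h5, h6⟩ := exists_suffix_peak hT.lip' hq hz
        (a := lam v - h₀) ((Nat.sub_le _ _).trans (le_peak _ _))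
      have hn2 : (N.walkVerts y p₂).Nodup := hnq.sublist (N.walkVerts_suffix h3.1).sublist
      obtain ⟨i, j, k1, k2, k3⟩ := hT.peak_le _ le_rfl h4 hn2 hz
      have hs : (p₂.map len').sum ≤ ((e :: p).map len').sum := by
        rw [← hrq]; simp; omega
      have hlen : p₂.length + 1 ≤ A₁ := by
        rw [← N.length_walkVerts y p₂, ← List.toFinset_card_of_nodup hn2]
        refine (Finset.card_le_card fun u hu => ?_).trans (hT.card_R_lt v hv hlv).le
        rw [List.mem_toFinset] at hu
        exact Finset.mem_filter.2 ⟨hT.mem_R _ _ (h3.reach.trans (h4.reach_of_mem hu)),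
          (le_peak_of_mem hu).trans h5⟩
      have := hRn y
      exact ⟨i, j, by omega, by omega, by omega⟩
    by_cases h1 : N.peak lam (N.tail e) (e :: p) ≤ N.peak lam (N.head e) p
    · obtain ⟨i, j, k1, k2, k3⟩ := ih hp' hn'
      exact ⟨i, j, k1, k2, by simp only [List.map_cons, List.sum_cons]; omega⟩
    have h2 : N.peak lam (N.tail e) (e :: p) = lam (N.tail e) := by
      simp only [peak] at h1 ⊢; omega
    rw [h2] at h1 ⊢
    by_cases hb : bad (N.tail e)
    · by_cases hl : h₀ ≤ lam (N.tail e)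
      · exact leave _ (e :: p) [] rfl (WalkIn.nil _ _) hp hb hl (by omega)
      · exact ⟨0, 0, by simp, by simp, by omega⟩
    by_cases hb' : bad (N.head e)
    · by_cases hl : h₀ ≤ lam (N.head e)
      · exact leave _ p [e] rfl (walkIn_cons.2 ⟨rfl, he, WalkIn.nil _ _⟩) hp' hb' hl (by omega)
      · exact ⟨0, 0, by simp, by simp, by omega⟩
    obtain ⟨i, j, k1, k2, k3⟩ := ih hp' hn'
    have h3 := hT.lip e he
    have h4 := hT.len_good e he hb hb'
    exact ⟨i, j, k1, k2, by simp only [List.map_cons, List.sum_cons]; omega⟩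

/-- The height of the start of a walk exceeds its `len'`-length by at most an error term. -/
theorem le_sum (hT : N.IsThin H lam len len' bad A R d h h₀ k A₁ A₂ κ) {n : ℕ}
    (hRn : ∀ x, (R x).card ≤ n) {x z : V} {p : List E} (hp : N.WalkIn H x z p)
    (hz : lam z = 0) :
    ∃ i j, A₂ * i ≤ 2 * n ∧ κ * j ≤ A₁ ∧
      lam x ≤ (p.map len').sum + (h + d * (k + 1)) * (1 + i + j) + 2 * h₀ + 3 * d := by
  obtain ⟨q, hq, hqH, hs⟩ := hp.exists_path
  obtain ⟨i, j, k1, k2, k3⟩ := hT.peak_le_of_card hRn hqH hq.2 hz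
  have h1 := le_peak (N := N) (lam := lam) x q
  have h2 := sum_map_le_of_sublist len' hs
  exact ⟨i, j, k1, k2, by omega⟩

end IsThin

end PeakLemmas

end DirPolyNet

/-- The integer parameters of the region growing procedure. -/
structure GrowthScale where
  /-- bound on the length of a half-edge -/
  K : ℕ
  /-- the basic distance scale -/
  δ : ℕ
  /-- number of vertices surely contained in a path of length `δ` -/
  κ : ℕ
  /-- depth at which central vertices are counted -/
  h : ℕ
  /-- depth at which reachable vertices are counted -/
  h₀ : ℕ
  /-- threshold for the number of central vertices -/
  k : ℕ
  /-- threshold for the number of reachable vertices -/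
  A₁ : ℕ
  /-- threshold for the number of far vertices -/
  A₂ : ℕ
  /-- threshold for the number of far pairs -/
  B : ℕ
  /-- loss of length per round -/
  θ : ℕ

/-- The compatibility conditions between the parameters, for a graph on `n` vertices. -/
structure GrowthScale.Admissible (P : GrowthScale) (n : ℕ) : Prop where
  κ_pos : 0 < P.κ
  h_pos : 0 < P.h
  k_pos : 0 < P.k
  A₁_pos : 0 < P.A₁
  A₂_pos : 0 < P.A₂
  B_pos : 0 < P.B
  δ_pos : 0 < P.δ
  h_le : P.h ≤ P.h₀
  le_δ : 2 * P.K * P.κ ≤ P.δ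
  loss : ∀ i j, P.A₂ * i ≤ 2 * n → P.κ * j ≤ P.A₁ →
    (P.h + 2 * P.K * (P.k + 1)) * (1 + i + j) + 2 * P.h₀ + 3 * (2 * P.K) ≤ P.θ

theorem mul_le_sum_range {R ℓ h : ℕ} (hℓ : h ≤ ℓ) (hR : ℓ ≤ R) {f : ℕ → ℝ} {c : ℝ}
    (hf : ∀ r, 0 ≤ f r) (hc : ∀ r, ℓ - h ≤ r → r < ℓ → c ≤ f r) :
    h * c ≤ ∑ r ∈ range R, f r := by
  calc (h : ℝ) * c = ∑ _r ∈ Ico (ℓ - h) ℓ, c := by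
        rw [Finset.sum_const, Nat.card_Ico, nsmul_eq_mul, Nat.sub_sub_self hℓ]
    _ ≤ ∑ r ∈ Ico (ℓ - h) ℓ, f r := Finset.sum_le_sum fun r hr => by
        rw [Finset.mem_Ico] at hr
        exact hc r hr.1 hr.2
    _ ≤ ∑ r ∈ range R, f r := Finset.sum_le_sum_of_subset_of_nonneg
        (fun r hr => by rw [Finset.mem_Ico] at hr; exact Finset.mem_range.2 (by omega))
        fun r _ _ => hf r

namespace DirPolyNet

section Reachability

variable {V E : Type} [Fintype V] [Fintype E] [DecidableEq V] [DecidableEq E]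
  (N : DirPolyNet V E) (E₀ : Finset E) (w : E → ℕ) (δ : ℕ)

/-- The vertices reachable from `v`. -/
noncomputable def reachSet (H : Finset E) (v : V) : Finset V :=
  univ.filter fun x => N.Reach H v x

/-- The pairs of vertices connected by a walk. -/
noncomputable def reachPairs (H : Finset E) : Finset (V × V) :=
  univ.filter fun z => N.Reach H z.1 z.2

/-- The vertices reachable from `v` at distance more than `2 * δ`. -/
noncomputable def farSet (H : Finset E) (v : V) : Finset V :=
  univ.filter fun y => N.Reach H v y ∧ ¬ N.Near E₀ w (2 * δ) v y

/-- The pairs consisting of a vertex near `v` and a vertex reachable from it but far from `v`. -/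
noncomputable def farPairs (H : Finset E) (v : V) : Finset (V × V) :=
  univ.filter fun z => N.Reach H v z.1 ∧ N.Near E₀ w δ v z.1 ∧ N.Reach H z.1 z.2 ∧
    ¬ N.Near E₀ w (2 * δ) v z.2

/-- The vertices near `v` reaching at least half of the vertices far from `v`. -/
noncomputable def centers (H : Finset E) (v : V) : Finset V :=
  univ.filter fun x => N.Reach H v x ∧ N.Near E₀ w δ v x ∧
    (N.farSet E₀ w δ H v).card ≤ 2 * (N.reachSet H x ∩ N.farSet E₀ w δ H v).card

variable {N E₀ w δ}

theorem reachSet_mono {H H' : Finset E} (hH : H' ⊆ H) (v : V) :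
    N.reachSet H' v ⊆ N.reachSet H v := fun x hx => by
  simp only [reachSet, Finset.mem_filter, Finset.mem_univ, true_and] at hx ⊢
  exact hx.mono hH

theorem reachPairs_mono {H H' : Finset E} (hH : H' ⊆ H) : N.reachPairs H' ⊆ N.reachPairs H :=
  fun x hx => by
  simp only [reachPairs, Finset.mem_filter, Finset.mem_univ, true_and] at hx ⊢
  exact hx.mono hH

theorem farSet_mono {H H' : Finset E} (hH : H' ⊆ H) (v : V) :
    N.farSet E₀ w δ H' v ⊆ N.farSet E₀ w δ H v := fun x hx => by
  simp only [farSet, Finset.mem_filter, Finset.mem_univ, true_and] at hx ⊢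
  exact ⟨hx.1.mono hH, hx.2⟩

theorem farPairs_mono {H H' : Finset E} (hH : H' ⊆ H) (v : V) :
    N.farPairs E₀ w δ H' v ⊆ N.farPairs E₀ w δ H v := fun x hx => by
  simp only [farPairs, Finset.mem_filter, Finset.mem_univ, true_and] at hx ⊢
  exact ⟨hx.1.mono hH, hx.2.1, hx.2.2.1.mono hH, hx.2.2.2⟩

theorem farPairs_subset_reachPairs (H : Finset E) (v : V) :
    N.farPairs E₀ w δ H v ⊆ N.reachPairs H := fun x hx => by
  simp only [farPairs, reachPairs, Finset.mem_filter, Finset.mem_univ, true_and] at hx ⊢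
  exact hx.2.2.1

theorem card_reachSet_le {H : Finset E} {x y : V} (h : N.Reach H x y) :
    (N.reachSet H y).card ≤ (N.reachSet H x).card := by
  refine Finset.card_le_card fun u hu => ?_
  simp only [reachSet, Finset.mem_filter, Finset.mem_univ, true_and] at hu ⊢
  exact h.trans hu

theorem mem_centers_self (H : Finset E) (v : V) : v ∈ N.centers E₀ w δ H v := by
  simp only [centers, Finset.mem_filter, Finset.mem_univ, true_and]
  refine ⟨Reach.refl _ _, Near.refl _ _ _ _, ?_⟩
  rw [Finset.inter_eq_right.2]
  · omega
  · intro x hx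
    simp only [farSet, reachSet, Finset.mem_filter, Finset.mem_univ, true_and] at hx ⊢
    exact hx.1

theorem two_mul_card_reachSet_le {H : Finset E} {v y : V} (h : N.Reach H v y)
    (hlt : 2 * (N.reachSet H y ∩ N.farSet E₀ w δ H v).card < (N.farSet E₀ w δ H v).card) :
    2 * (N.reachSet H y).card + (N.farSet E₀ w δ H v).card ≤ 2 * (N.reachSet H v).card := by
  have hsub : N.farSet E₀ w δ H v ⊆ N.reachSet H v := fun x hx => by
    simp only [farSet, reachSet, Finset.mem_filter, Finset.mem_univ, true_and] at hx ⊢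
    exact hx.1
  have hsub' : N.reachSet H y ⊆ N.reachSet H v := fun x hx => by
    simp only [reachSet, Finset.mem_filter, Finset.mem_univ, true_and] at hx ⊢
    exact h.trans hx
  have h1 := Finset.card_inter_add_card_sdiff (N.reachSet H y) (N.farSet E₀ w δ H v)
  have h2 := Finset.card_sdiff_add_card_eq_card hsub
  have h3 : (N.reachSet H y \ N.farSet E₀ w δ H v).card ≤
      (N.reachSet H v \ N.farSet E₀ w δ H v).card :=
    Finset.card_le_card (Finset.sdiff_subset_sdiff hsub' subset_rfl)
  omega

section LevelCut

variable {lam : V → ℕ} {r : ℕ} {H : Finset E} {v : V}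

theorem not_reach_of_levelCut {x : V} (hv : r < lam v) (hx : lam x ≤ r) :
    ¬ N.Reach (H \ N.levelCut H lam r) v x := by
  rintro ⟨p, hp⟩
  exact absurd (hp.lt_of_levelCut hv) (not_lt.2 hx)

theorem card_reachSet_levelCut (hv : r < lam v) :
    (N.reachSet (H \ N.levelCut H lam r) v).card +
      ((N.reachSet H v).filter fun x => lam x ≤ r).card ≤ (N.reachSet H v).card := by
  rw [← Finset.card_union_of_disjoint]
  · exact Finset.card_le_card (Finset.union_subset (reachSet_mono Finset.sdiff_subset v)
      (Finset.filter_subset _ _))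
  · refine Finset.disjoint_left.2 fun x hx hx' => ?_
    simp only [reachSet, Finset.mem_filter, Finset.mem_univ, true_and] at hx hx'
    exact not_reach_of_levelCut hv hx'.2 hx

theorem card_farSet_levelCut (hv : r < lam v) :
    (N.farSet E₀ w δ (H \ N.levelCut H lam r) v).card +
      ((N.farSet E₀ w δ H v).filter fun x => lam x ≤ r).card ≤ (N.farSet E₀ w δ H v).card := by
  rw [← Finset.card_union_of_disjoint]
  · exact Finset.card_le_card (Finset.union_subset (farSet_mono Finset.sdiff_subset v)
      (Finset.filter_subset _ _))
  · refine Finset.disjoint_left.2 fun x hx hx' => ?_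
    simp only [farSet, Finset.mem_filter, Finset.mem_univ, true_and] at hx hx'
    exact not_reach_of_levelCut hv hx'.2 hx.1

theorem card_farPairs_levelCut (hv : r < lam v) :
    2 * (N.farPairs E₀ w δ (H \ N.levelCut H lam r) v).card +
      ((N.centers E₀ w δ H v).filter fun x => lam x ≤ r).card * (N.farSet E₀ w δ H v).card ≤
      2 * (N.farPairs E₀ w δ H v).card := by
  set T := (N.centers E₀ w δ H v).filter fun x => lam x ≤ r with hT
  set U := T.sigma fun x => N.reachSet H x ∩ N.farSet E₀ w δ H v with hU
  have hTm : ∀ x ∈ T, N.Reach H v x ∧ N.Near E₀ w δ v x ∧ lam x ≤ r ∧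
      (N.farSet E₀ w δ H v).card ≤ 2 * (N.reachSet H x ∩ N.farSet E₀ w δ H v).card := by
    intro x hx
    simp only [hT, centers, Finset.mem_filter, Finset.mem_univ, true_and] at hx
    tauto
  have hcard : T.card * (N.farSet E₀ w δ H v).card ≤ 2 * U.card := by
    rw [hU, Finset.card_sigma, Finset.mul_sum]
    exact Finset.card_nsmul_le_sum T _ _ fun x hx => (hTm x hx).2.2.2
  have hle : (N.farPairs E₀ w δ (H \ N.levelCut H lam r) v).card + U.card ≤
      (N.farPairs E₀ w δ H v).card := by
    have hinj : Set.InjOn (fun z : (_ : V) × V => (z.1, z.2)) (U : Set ((_ : V) × V)) := by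
      rintro ⟨a, b⟩ _ ⟨c, d⟩ _ h
      simpa using h
    rw [← Finset.card_image_of_injOn hinj, ← Finset.card_union_of_disjoint]
    · refine Finset.card_le_card (Finset.union_subset (farPairs_mono Finset.sdiff_subset v) ?_)
      intro z hz
      obtain ⟨⟨a, b⟩, hab, rfl⟩ := Finset.mem_image.1 hz
      rw [hU, Finset.mem_sigma] at hab
      have h1 := hTm a hab.1
      have h2 := hab.2
      simp only [reachSet, farSet, Finset.mem_inter, Finset.mem_filter, Finset.mem_univ,
        true_and] at h2
      simp only [farPairs, Finset.mem_filter, Finset.mem_univ, true_and]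
      exact ⟨h1.1, h1.2.1, h2.1, h2.2.2⟩
    · refine Finset.disjoint_left.2 fun z hz hz' => ?_
      obtain ⟨⟨a, b⟩, hab, rfl⟩ := Finset.mem_image.1 hz'
      rw [hU, Finset.mem_sigma] at hab
      simp only [farPairs, Finset.mem_filter, Finset.mem_univ, true_and] at hz
      exact not_reach_of_levelCut hv (hTm a hab.1).2.2.1 hz.1
  omega

variable (N E₀ w) in
/-- The potential of the vertex `v`. -/
noncomputable def vertexPotential (P : GrowthScale) (H : Finset E) (v : V) : ℝ :=
  (N.reachSet H v).card / (P.A₁ * P.h₀ : ℝ) +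
    min ((N.farSet E₀ w P.δ H v).card : ℝ) P.A₂ / (P.κ * P.h₀ : ℝ) +
    2 * min ((N.farPairs E₀ w P.δ H v).card : ℝ) P.B / (P.k * P.A₂ * P.h : ℝ)

theorem vertexPotential_nonneg (P : GrowthScale) (H : Finset E) (v : V) :
    0 ≤ N.vertexPotential E₀ w P H v := by
  unfold vertexPotential
  positivity

theorem vertexPotential_mono (P : GrowthScale) {H H' : Finset E} (hH : H' ⊆ H) (v : V) :
    N.vertexPotential E₀ w P H' v ≤ N.vertexPotential E₀ w P H v := by
  have h1 := Finset.card_le_card (reachSet_mono (N := N) hH v)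
  have h2 := Finset.card_le_card (farSet_mono (N := N) (E₀ := E₀) (w := w) (δ := P.δ) hH v)
  have h3 := Finset.card_le_card (farPairs_mono (N := N) (E₀ := E₀) (w := w) (δ := P.δ) hH v)
  unfold vertexPotential
  gcongr

/-- Cutting at a random level decreases the potential of a good vertex. -/
theorem one_le_sum_vertexPotential_sub {P : GrowthScale} {n : ℕ} (hP : P.Admissible n) {R : ℕ}
    (hR : lam v ≤ R) (hv : P.h₀ ≤ lam v)
    (hB : (N.farPairs E₀ w P.δ H v).card ≤ P.B)
    (hpoor : ∀ r < lam v, P.κ ≤ ((N.farSet E₀ w P.δ H v).filter fun x => lam x ≤ r).card)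
    (hgood : P.A₁ ≤ ((N.reachSet H v).filter fun x => lam x ≤ lam v - P.h₀).card ∨
      (N.farSet E₀ w P.δ H v).card < P.A₂ ∨
      P.k ≤ ((N.centers E₀ w P.δ H v).filter fun x => lam x ≤ lam v - P.h).card) :
    1 ≤ ∑ r ∈ range R, (N.vertexPotential E₀ w P H v -
      N.vertexPotential E₀ w P (H \ N.levelCut H lam r) v) := by
  have hh := hP.h_pos
  have hh₀ : 0 < P.h₀ := hh.trans_le hP.h_le
  have hA₁ := hP.A₁_pos
  have hA₂ := hP.A₂_pos
  have hκ := hP.κ_pos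
  have hk := hP.k_pos
  have hnn : ∀ r, 0 ≤ N.vertexPotential E₀ w P H v -
      N.vertexPotential E₀ w P (H \ N.levelCut H lam r) v := fun r =>
    sub_nonneg.2 (vertexPotential_mono P Finset.sdiff_subset v)
  have m1 : ∀ r, ((N.reachSet (H \ N.levelCut H lam r) v).card : ℝ) / (P.A₁ * P.h₀ : ℝ) ≤
      (N.reachSet H v).card / (P.A₁ * P.h₀ : ℝ) := fun r => by
    have := Finset.card_le_card
      (reachSet_mono (N := N) (H := H) (H' := H \ N.levelCut H lam r) Finset.sdiff_subset v)
    gcongr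
  have m2 : ∀ r, min ((N.farSet E₀ w P.δ (H \ N.levelCut H lam r) v).card : ℝ) P.A₂ /
      (P.κ * P.h₀ : ℝ) ≤ min ((N.farSet E₀ w P.δ H v).card : ℝ) P.A₂ / (P.κ * P.h₀ : ℝ) :=
    fun r => by
    have := Finset.card_le_card (farSet_mono (N := N) (E₀ := E₀) (w := w) (δ := P.δ) (H := H)
      (H' := H \ N.levelCut H lam r) Finset.sdiff_subset v)
    gcongr
  have m3 : ∀ r, 2 * min ((N.farPairs E₀ w P.δ (H \ N.levelCut H lam r) v).card : ℝ) P.B /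
      (P.k * P.A₂ * P.h : ℝ) ≤
      2 * min ((N.farPairs E₀ w P.δ H v).card : ℝ) P.B / (P.k * P.A₂ * P.h : ℝ) := fun r => by
    have := Finset.card_le_card (farPairs_mono (N := N) (E₀ := E₀) (w := w) (δ := P.δ) (H := H)
      (H' := H \ N.levelCut H lam r) Finset.sdiff_subset v)
    gcongr
  have hgood : P.A₁ ≤ ((N.reachSet H v).filter fun x => lam x ≤ lam v - P.h₀).card ∨
      (N.farSet E₀ w P.δ H v).card < P.A₂ ∨ P.A₂ ≤ (N.farSet E₀ w P.δ H v).card ∧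
      P.k ≤ ((N.centers E₀ w P.δ H v).filter fun x => lam x ≤ lam v - P.h).card := by
    have := lt_or_ge (N.farSet E₀ w P.δ H v).card P.A₂
    tauto
  rcases hgood with hg | hg | ⟨hfar, hg⟩
  · have key := mul_le_sum_range (c := ((P.h₀ : ℝ))⁻¹) hv hR hnn fun r hr hr' => by
      have h1 := card_reachSet_levelCut (N := N) (H := H) hr'
      have h2 : ((N.reachSet H v).filter fun x => lam x ≤ lam v - P.h₀).card ≤
          ((N.reachSet H v).filter fun x => lam x ≤ r).card :=
        Finset.card_le_card fun x hx => by
          rw [Finset.mem_filter] at hx ⊢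
          exact ⟨hx.1, hx.2.trans hr⟩
      have h3 : ((N.reachSet (H \ N.levelCut H lam r) v).card : ℝ) + P.A₁ ≤
          (N.reachSet H v).card := by exact_mod_cast (by omega)
      have h4 : ((N.reachSet (H \ N.levelCut H lam r) v).card : ℝ) / (P.A₁ * P.h₀ : ℝ) +
          (P.h₀ : ℝ)⁻¹ ≤ (N.reachSet H v).card / (P.A₁ * P.h₀ : ℝ) := by
        have : (P.h₀ : ℝ)⁻¹ = P.A₁ / (P.A₁ * P.h₀ : ℝ) := by field_simp
        rw [this, ← add_div]
        gcongr
      have := m2 r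
      have := m3 r
      unfold vertexPotential
      linarith
    rwa [mul_inv_cancel₀ (by positivity)] at key
  · have key := mul_le_sum_range (c := ((P.h₀ : ℝ))⁻¹) hv hR hnn fun r hr hr' => by
      have h1 := card_farSet_levelCut (N := N) (E₀ := E₀) (w := w) (δ := P.δ) (H := H) hr'
      have h2 := hpoor r hr'
      have h3 : min ((N.farSet E₀ w P.δ (H \ N.levelCut H lam r) v).card : ℝ) P.A₂ + P.κ ≤
          min ((N.farSet E₀ w P.δ H v).card : ℝ) P.A₂ := by
        rw [min_eq_left (a := ((N.farSet E₀ w P.δ H v).card : ℝ)) (by exact_mod_cast hg.le)]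
        rw [min_eq_left (by exact_mod_cast (by omega))]
        exact_mod_cast (by omega)
      have h4 : min ((N.farSet E₀ w P.δ (H \ N.levelCut H lam r) v).card : ℝ) P.A₂ /
          (P.κ * P.h₀ : ℝ) + (P.h₀ : ℝ)⁻¹ ≤
          min ((N.farSet E₀ w P.δ H v).card : ℝ) P.A₂ / (P.κ * P.h₀ : ℝ) := by
        have : (P.h₀ : ℝ)⁻¹ = P.κ / (P.κ * P.h₀ : ℝ) := by field_simp
        rw [this, ← add_div]
        gcongr
      have := m1 r
      have := m3 r
      unfold vertexPotential
      linarith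
    rwa [mul_inv_cancel₀ (by positivity)] at key
  · have key := mul_le_sum_range (c := ((P.h : ℝ))⁻¹) (hP.h_le.trans hv) hR hnn fun r hr hr' => by
      have h1 := card_farPairs_levelCut (N := N) (E₀ := E₀) (w := w) (δ := P.δ) (H := H) hr'
      have h2 : ((N.centers E₀ w P.δ H v).filter fun x => lam x ≤ lam v - P.h).card ≤
          ((N.centers E₀ w P.δ H v).filter fun x => lam x ≤ r).card :=
        Finset.card_le_card fun x hx => by
          rw [Finset.mem_filter] at hx ⊢
          exact ⟨hx.1, hx.2.trans hr⟩
      have h3 := Nat.mul_le_mul (hg.trans h2) hfar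
      have h3 : 2 * min ((N.farPairs E₀ w P.δ (H \ N.levelCut H lam r) v).card : ℝ) P.B +
          P.k * P.A₂ ≤ 2 * min ((N.farPairs E₀ w P.δ H v).card : ℝ) P.B := by
        rw [min_eq_left (a := ((N.farPairs E₀ w P.δ H v).card : ℝ)) (by exact_mod_cast hB)]
        rw [min_eq_left (by exact_mod_cast (by omega))]
        exact_mod_cast (by omega)
      have h4 : 2 * min ((N.farPairs E₀ w P.δ (H \ N.levelCut H lam r) v).card : ℝ) P.B /
          (P.k * P.A₂ * P.h : ℝ) + (P.h : ℝ)⁻¹ ≤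
          2 * min ((N.farPairs E₀ w P.δ H v).card : ℝ) P.B / (P.k * P.A₂ * P.h : ℝ) := by
        have : (P.h : ℝ)⁻¹ = P.k * P.A₂ / (P.k * P.A₂ * P.h : ℝ) := by field_simp
        rw [this, ← add_div]
        gcongr
      have := m1 r
      have := m2 r
      unfold vertexPotential
      linarith
    rwa [mul_inv_cancel₀ (by positivity)] at key

end LevelCut

end Reachability

end DirPolyNet

namespace DirPolyNet

section Growth

variable {V E : Type} [Fintype V] [Fintype E] [DecidableEq V] [DecidableEq E]
  {N : DirPolyNet V E} {E₀ H : Finset E} {w : E → ℕ} {δ : ℕ}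

/-- A vertex which reaches `t`, but only at a large distance, has many far vertices
close to `t`. -/
theorem le_card_filter_farSet {d κ : ℕ} (hκ : 0 < κ) (hw : ∀ e ∈ E₀, w e ≤ d) (hδ : d * κ ≤ δ)
    (hH : H ⊆ E₀) {v t : V} (hvt : N.Reach H v t) (hn : ¬ N.Near E₀ w (4 * δ) v t) {lam : V → ℕ}
    (hlam : ∀ u, N.Near E₀ w (4 * δ) u t → N.Reach H u t → lam u = 0) (r : ℕ) :
    κ ≤ ((N.farSet E₀ w δ H v).filter fun x => lam x ≤ r).card := by
  obtain ⟨p', hp'⟩ := hvt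
  obtain ⟨p, hp, hpH, -⟩ := hp'.exists_path
  have hlen : κ ≤ p.length := by
    by_contra hlt
    refine hn ⟨p, hpH.mono hH, ?_⟩
    have h1 := sum_map_le_length_mul w d p fun e he => hw e (hH (hpH.2 e he))
    have h2 : d * p.length ≤ d * κ := Nat.mul_le_mul_left d (by omega)
    omega
  rw [← List.take_append_drop (p.length + 1 - κ) p] at hp hpH
  obtain ⟨y, h1, h2⟩ := walkIn_append.1 hpH
  have h3 := hp.suffix h1.1 h2.1
  have hlen2 : (p.drop (p.length + 1 - κ)).length + 1 = κ := by
    rw [List.length_drop]; omega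
  generalize p.drop (p.length + 1 - κ) = q at *
  rw [← hlen2, ← N.length_walkVerts y q, ← List.toFinset_card_of_nodup h3.2]
  refine Finset.card_le_card fun u hu => ?_
  rw [List.mem_toFinset] at hu
  obtain ⟨q₁, q₂, rfl, k1, k2⟩ := N.mem_walkVerts_split h2.1 hu
  have k1' : N.WalkIn H y u q₁ := ⟨k1, fun e he => h2.2 e (List.mem_append_left _ he)⟩
  have k2' : N.WalkIn H u t q₂ := ⟨k2, fun e he => h2.2 e (List.mem_append_right _ he)⟩
  have hnear : N.Near E₀ w δ u t := by
    refine ⟨q₂, k2'.mono hH, ?_⟩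
    have h1 := sum_map_le_length_mul w d q₂ fun e he => hw e (hH (k2'.2 e he))
    rw [List.length_append] at hlen2
    have h2 : d * q₂.length ≤ d * κ := Nat.mul_le_mul_left d (by omega)
    omega
  simp only [farSet, Finset.mem_filter, Finset.mem_univ, true_and]
  refine ⟨⟨h1.reach.trans k1'.reach, fun hnn => hn ((hnn.trans hnear).mono (by omega))⟩, ?_⟩
  rw [hlam u (hnear.mono (by omega)) k2'.reach]
  exact Nat.zero_le _

variable (N) in
/-- The length of an edge when only the half-edges at the vertices of `G` are counted. -/
def partialLen (α β : E → ℕ) (G : Finset V) (e : E) : ℕ :=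
  (if N.tail e ∈ G then α e else 0) + (if N.head e ∈ G then β e else 0)

theorem exists_walkIn_sum_le {α β : E → ℕ} {K : ℕ} (hK : ∀ e ∈ H, β e ≤ K) {Z : V → Prop} {t : V}
    (hZ : ∀ z, Z z → N.Reach H z t) {G : Finset V} (hG : ∀ v, N.Reach H v t → ¬ Z v → v ∈ G)
    {x z : V} {p : List E} (hp : N.WalkIn H x z p) (hz : Z z) :
    ∃ y q, Z y ∧ N.WalkIn H x y q ∧ (q.map fun e => α e + β e).sum ≤
      (p.map (N.partialLen α β G)).sum + if Z x then 0 else K := by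
  induction p generalizing x with
  | nil =>
    obtain rfl : x = z := hp.1
    exact ⟨x, [], hz, hp, by simp⟩
  | cons e p ih =>
    have hreach := hp.reach.trans (hZ z hz)
    obtain ⟨rfl, he, hp'⟩ := walkIn_cons.1 hp
    by_cases hx : Z (N.tail e)
    · exact ⟨_, [], hx, WalkIn.nil _ _, by simp⟩
    obtain ⟨y, q, hy, hq, hs⟩ := ih hp'
    refine ⟨y, e :: q, hy, walkIn_cons.2 ⟨rfl, he, hq⟩, ?_⟩
    have h1 := hG _ hreach hx
    have h2 := hK e he
    simp only [List.map_cons, List.sum_cons, partialLen, if_pos h1, if_neg hx]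
    by_cases h3 : Z (N.head e)
    · rw [if_pos h3] at hs
      omega
    · rw [if_neg h3] at hs
      rw [if_pos (hG _ (hp'.reach.trans (hZ z hz)) h3)]
      omega

variable (N E₀) in
/-- The distance from `v` to `x`, truncated at `R`. -/
noncomputable def distFrom (w : E → ℕ) (R : ℕ) (v x : V) : ℕ :=
  sInf {k | k = R ∨ ∃ p, N.WalkIn E₀ v x p ∧ k = (p.map w).sum}

theorem distFrom_cases (w : E → ℕ) (R : ℕ) (v x : V) : N.distFrom E₀ w R v x = R ∨
    ∃ p, N.WalkIn E₀ v x p ∧ N.distFrom E₀ w R v x = (p.map w).sum :=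
  Nat.sInf_mem (s := {k | k = R ∨ ∃ p, N.WalkIn E₀ v x p ∧ k = (p.map w).sum}) ⟨R, Or.inl rfl⟩

theorem distFrom_le (w : E → ℕ) (R : ℕ) (v x : V) : N.distFrom E₀ w R v x ≤ R :=
  Nat.sInf_le (Or.inl rfl)

theorem distFrom_le_of_near {R c : ℕ} {v x : V} (h : N.Near E₀ w c v x) :
    N.distFrom E₀ w R v x ≤ c := by
  obtain ⟨p, hp, hc⟩ := h
  exact (Nat.sInf_le (Or.inr ⟨p, hp, rfl⟩)).trans hc

theorem distFrom_eq_of_not_near {R : ℕ} {v x : V} (h : ¬ N.Near E₀ w R v x) :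
    N.distFrom E₀ w R v x = R := by
  rcases distFrom_cases (N := N) (E₀ := E₀) w R v x with h1 | ⟨p, hp, h1⟩
  · exact h1
  · exact absurd ⟨p, hp, h1 ▸ distFrom_le w R v x⟩ h

theorem distFrom_head_le {R : ℕ} {v : V} {e : E} (he : e ∈ E₀) :
    N.distFrom E₀ w R v (N.head e) ≤ N.distFrom E₀ w R v (N.tail e) + w e := by
  rcases distFrom_cases (N := N) (E₀ := E₀) w R v (N.tail e) with h | ⟨p, hp, h⟩
  · rw [h]
    exact (distFrom_le ..).trans (Nat.le_add_right _ _)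
  · rw [h]
    refine distFrom_le_of_near ⟨p ++ [e], hp.append (walkIn_cons.2 ⟨rfl, he, WalkIn.nil _ _⟩), ?_⟩
    simp

/-- The hypotheses of the region growing procedure with `m` rounds. -/
structure IsGrowable (N : DirPolyNet V E) (E₀ : Finset E) (α β : E → ℕ) (cP cM : V → ℝ)
    (P : GrowthScale) (m D : ℕ) {ι : Type} (s t : ι → V) : Prop where
  leveled : N.IsLeveled E₀ α β P.K (16 * P.δ) cP cM
  admissible : P.Admissible (Fintype.card V)
  B_le : P.B ≤ 2 ^ m
  le_sum : ∀ i p, N.WalkIn E₀ (s i) (t i) p → D ≤ (p.map fun e => α e + β e).sum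
  le_D : m * P.θ + 12 * P.δ + P.K ≤ D

variable (N E₀) in
/-- The potential controlling the total cost of the cuts. -/
noncomputable def potential (w : E → ℕ) (c : V → ℝ) (P : GrowthScale) (H : Finset E) : ℝ :=
  2 * (16 * P.δ) * (harmonic P.K : ℝ) * ∑ v, c v * N.vertexPotential E₀ w P H v +
    16 * (harmonic P.K : ℝ) * (∑ v, c v) * (N.reachPairs H).card / P.B

variable (N E₀) in
/-- A cheap cut decreasing the number of connected pairs and paid for by the potential. -/
def HasCheapCut (w : E → ℕ) (c : V → ℝ) (P : GrowthScale) (H : Finset E) : Prop :=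
  ∃ F x, N.Cheap F x ∧ x ≤ N.potential E₀ w c P H - N.potential E₀ w c P (H \ F) ∧
    (N.reachPairs (H \ F)).card < (N.reachPairs H).card

theorem harmonic_cast_nonneg (K : ℕ) : 0 ≤ (harmonic K : ℝ) := by
  unfold harmonic
  push_cast
  positivity

/-- Cutting many pairs pays for a cut of small cost. -/
theorem hasCheapCut_of_card {c : V → ℝ} (hc : ∀ v, 0 ≤ c v) {P : GrowthScale} (hB : 0 < P.B)
    {F : Finset E} {x : ℝ} {b : ℕ} (hb : 0 < b) (hF : N.Cheap F x)
    (hcard : (N.reachPairs (H \ F)).card + b ≤ (N.reachPairs H).card)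
    (hx : x ≤ 16 * (harmonic P.K : ℝ) * (∑ v, c v) * b / P.B) : N.HasCheapCut E₀ w c P H := by
  refine ⟨F, x, hF, ?_, by omega⟩
  have h1 : 2 * (16 * (P.δ : ℝ)) * (harmonic P.K : ℝ) *
      ∑ v, c v * N.vertexPotential E₀ w P (H \ F) v ≤
      2 * (16 * P.δ) * (harmonic P.K : ℝ) * ∑ v, c v * N.vertexPotential E₀ w P H v := by
    have := harmonic_cast_nonneg P.K
    refine mul_le_mul_of_nonneg_left (Finset.sum_le_sum fun v _ => ?_) (by positivity)
    exact mul_le_mul_of_nonneg_left (vertexPotential_mono P Finset.sdiff_subset v) (hc v)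
  have h2 : 16 * (harmonic P.K : ℝ) * (∑ v, c v) * (N.reachPairs (H \ F)).card / P.B +
      16 * (harmonic P.K : ℝ) * (∑ v, c v) * b / P.B ≤
      16 * (harmonic P.K : ℝ) * (∑ v, c v) * (N.reachPairs H).card / P.B := by
    rw [← add_div, ← mul_add]
    have := harmonic_cast_nonneg P.K
    have h3 : 0 ≤ ∑ v, c v := Finset.sum_nonneg fun v _ => hc v
    have h4 : ((N.reachPairs (H \ F)).card : ℝ) + b ≤ (N.reachPairs H).card := by
      exact_mod_cast hcard
    gcongr
  unfold potential
  linarith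

theorem card_reachPairs_sdiff_lt {F : Finset E} {x y : V} (h : N.Reach H x y)
    (h' : ¬ N.Reach (H \ F) x y) : (N.reachPairs (H \ F)).card + 1 ≤ (N.reachPairs H).card := by
  refine Finset.card_lt_card ⟨reachPairs_mono Finset.sdiff_subset, fun hsub => h' ?_⟩
  have := @hsub (x, y) (by simpa [reachPairs] using h)
  simpa [reachPairs] using this

variable {α β : E → ℕ} {cP cM : V → ℝ} {P : GrowthScale} {m D : ℕ} {ι : Type} {s t : ι → V}

namespace IsGrowable

/-- A vertex with many far pairs yields a cheap cut. -/
theorem hasCheapCut_of_farPairs (h : N.IsGrowable E₀ α β cP cM P m D s t) (hH : H ⊆ E₀) {v : V}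
    (hv : P.B < (N.farPairs E₀ (fun e => α e + β e) P.δ H v).card) :
    N.HasCheapCut E₀ (fun e => α e + β e) (fun v => cP v + cM v) P H := by
  have hB := h.admissible.B_pos
  have hδ := h.admissible.δ_pos
  set w : E → ℕ := fun e => α e + β e with hw
  set lam : V → ℕ := fun x => 2 * P.δ - N.distFrom E₀ w (2 * P.δ) v x with hlam
  obtain ⟨cost, hc1, hc2⟩ := h.leveled.exists_levelCut_cost hH lam univ (fun e he => by
    have := distFrom_head_le (N := N) (w := w) (R := 2 * P.δ) (v := v) (hH he)
    simp only [hlam, Finset.mem_univ, if_true]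
    simp only [hw] at this ⊢
    omega) P.δ
  have hW : 0 ≤ ∑ v, (cP v + cM v) :=
    Finset.sum_nonneg fun v _ => add_nonneg (h.leveled.cP_nonneg v) (h.leveled.cM_nonneg v)
  obtain ⟨r, hr, hcost⟩ := Finset.exists_le_of_sum_le (s := range P.δ) ⟨0, Finset.mem_range.2 hδ⟩
    (f := cost) (g := fun _ => 16 * (harmonic P.K : ℝ) * ∑ v, (cP v + cM v)) (by
      rw [Finset.sum_const, Finset.card_range, nsmul_eq_mul]
      linarith)
  rw [Finset.mem_range] at hr
  refine hasCheapCut_of_card (fun v => add_nonneg (h.leveled.cP_nonneg v) (h.leveled.cM_nonneg v))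
    hB (b := (N.farPairs E₀ w P.δ H v).card) (by omega) (hc1 r) ?_ (hcost.trans ?_)
  · rw [← Finset.card_union_of_disjoint]
    · exact Finset.card_le_card (Finset.union_subset (reachPairs_mono Finset.sdiff_subset)
        (farPairs_subset_reachPairs H v))
    · refine Finset.disjoint_left.2 fun z hz hz' => ?_
      simp only [reachPairs, farPairs, Finset.mem_filter, Finset.mem_univ, true_and] at hz hz'
      have h1 := distFrom_le_of_near (R := 2 * P.δ) hz'.2.1
      have h2 := distFrom_eq_of_not_near hz'.2.2.2
      refine not_reach_of_levelCut (lam := lam) (r := r) ?_ ?_ hz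
      · simp only [hlam]; omega
      · simp only [hlam]; omega
  · have hle : ((P.B : ℕ) : ℝ) ≤ (N.farPairs E₀ w P.δ H v).card := by exact_mod_cast hv.le
    have hB' : (0 : ℝ) < P.B := by exact_mod_cast hB
    have := harmonic_cast_nonneg P.K
    rw [le_div_iff₀ hB']
    gcongr

/-- One round: either there is a cheap cut, or half of the cost of the vertices can be ignored. -/
theorem hasCheapCut_or_halve (h : N.IsGrowable E₀ α β cP cM P m D s t) (hH : H ⊆ E₀)
    (hfar : ∀ v, (N.farPairs E₀ (fun e => α e + β e) P.δ H v).card ≤ P.B) {x y : V}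
    (hxy : N.Reach H x y) {Z : V → Prop} {G : Finset V}
    (hZ : ∀ z, Z z ↔ N.Near E₀ (fun e => α e + β e) (4 * P.δ) z y ∧ N.Reach H z y)
    (hG : ∀ v ∈ G, N.Reach H v y ∧ ¬ Z v) {R : ℕ} (hR : 0 < R)
    (hlen : ∀ z p, Z z → N.WalkIn H x z p → R + P.θ ≤ (p.map (N.partialLen α β G)).sum) :
    N.HasCheapCut E₀ (fun e => α e + β e) (fun v => cP v + cM v) P H ∨
      ∃ G' ⊆ G, 2 * ∑ v ∈ G', (cP v + cM v) ≤ ∑ v ∈ G, (cP v + cM v) ∧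
        ∀ z p, Z z → N.WalkIn H x z p → R ≤ (p.map (N.partialLen α β G')).sum := by
  set w : E → ℕ := fun e => α e + β e with hw
  set lam := N.distTo H (N.partialLen α β G) Z (R + P.θ) with hlam
  have hwK : ∀ e ∈ E₀, w e ≤ 2 * P.K := fun e he => by
    have := h.leveled.le_tail e he
    have := h.leveled.le_head e he
    simp only [hw]
    omega
  have hZy : Z y := (hZ y).2 ⟨Near.refl _ _ _ _, Reach.refl _ _⟩
  have hx : lam x = R + P.θ := by
    rcases distTo_cases (N := N) H (N.partialLen α β G) Z (R + P.θ) x with h1 | ⟨z, p, h1, h2, h3⟩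
    · exact h1
    · exact le_antisymm (distTo_le ..) ((hlen z p h1 h2).trans_eq h3.symm)
  have hy : lam y = 0 := distTo_eq_zero _ hZy
  set G' := G.filter fun v => P.h₀ ≤ lam v ∧
    (P.A₁ ≤ ((N.reachSet H v).filter fun x => lam x ≤ lam v - P.h₀).card ∨
      (N.farSet E₀ w P.δ H v).card < P.A₂ ∨
      P.k ≤ ((N.centers E₀ w P.δ H v).filter fun x => lam x ≤ lam v - P.h).card) with hG'
  by_cases hC : 2 * ∑ v ∈ G', (cP v + cM v) ≤ ∑ v ∈ G, (cP v + cM v)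
  · right
    refine ⟨G', Finset.filter_subset _ _, hC, fun z p hz hp => ?_⟩
    have hthin : N.IsThin H lam (N.partialLen α β G) (N.partialLen α β G')
        (fun v => v ∈ G ∧ v ∉ G') (N.centers E₀ w P.δ H) (N.reachSet H)
        (2 * P.K) P.h P.h₀ P.k P.A₁ P.A₂ P.κ := by
      have hbad : ∀ v, v ∈ G ∧ v ∉ G' → P.h₀ ≤ lam v →
          ((N.reachSet H v).filter fun x => lam x ≤ lam v - P.h₀).card < P.A₁ ∧
          P.A₂ ≤ (N.farSet E₀ w P.δ H v).card ∧
          ((N.centers E₀ w P.δ H v).filter fun x => lam x ≤ lam v - P.h).card < P.k := by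
        intro v hv hlv
        have h1 := hv.2
        rw [hG', Finset.mem_filter] at h1
        by_contra h2
        refine h1 ⟨hv.1, hlv, ?_⟩
        omega
      refine ⟨fun e he => distTo_tail_le he, fun e he => ?_, fun e he h1 h2 => ?_,
        fun v => mem_centers_self H v, fun v x hvx => ?_, fun a b hab => card_reachSet_le hab,
        fun v hv hlv => (hbad v hv hlv).2.2, fun v hv hlv => (hbad v hv hlv).1,
        fun v u q hv hlv hq hu => ?_⟩
      · have h1 := hwK e (hH he)
        simp only [hw] at h1
        unfold partialLen
        split_ifs <;> omega
      · unfold partialLen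
        have h1' : N.tail e ∈ G → N.tail e ∈ G' := fun h => by by_contra h'; exact h1 ⟨h, h'⟩
        have h2' : N.head e ∈ G → N.head e ∈ G' := fun h => by by_contra h'; exact h2 ⟨h, h'⟩
        split_ifs <;> first | omega | tauto
      · simpa [reachSet] using hvx
      · by_cases hnear : N.Near E₀ w P.δ v u
        · left
          have h1 : 2 * (N.reachSet H u ∩ N.farSet E₀ w P.δ H v).card <
              (N.farSet E₀ w P.δ H v).card := by
            by_contra h1
            refine hu ?_
            simp only [centers, Finset.mem_filter, Finset.mem_univ, true_and]
            exact ⟨hq.reach, hnear, not_lt.1 h1⟩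
          have h2 := two_mul_card_reachSet_le hq.reach h1
          have h3 := (hbad v hv hlv).2.1
          omega
        · right
          by_contra hle
          refine hnear ⟨q, hq.mono hH, ?_⟩
          have h1 := sum_map_le_length_mul w _ q fun e he => hwK e (hH (hq.2 e he))
          have h2 : 2 * P.K * q.length ≤ 2 * P.K * P.κ := Nat.mul_le_mul_left _ (by omega)
          have h3 := h.admissible.le_δ
          omega
    obtain ⟨i, j, h1, h2, h3⟩ := hthin.le_sum (n := Fintype.card V)
      (fun x => Finset.card_le_univ _) hp (distTo_eq_zero _ hz)
    have h4 := h.admissible.loss i j h1 h2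
    omega
  · left
    obtain ⟨cost, hc1, hc2⟩ := h.leveled.exists_levelCut_cost hH lam G (fun e he => by
      exact distTo_tail_le he) (R + P.θ)
    have hc : ∀ v, 0 ≤ cP v + cM v := fun v =>
      add_nonneg (h.leveled.cP_nonneg v) (h.leveled.cM_nonneg v)
    have hHc := harmonic_cast_nonneg P.K
    have hB := h.admissible.B_pos
    set Ψ : Finset E → ℝ := fun H => ∑ v, (cP v + cM v) * N.vertexPotential E₀ w P H v with hΨ
    have hgain : ∑ v ∈ G', (cP v + cM v) ≤
        ∑ r ∈ range (R + P.θ), (Ψ H - Ψ (H \ N.levelCut H lam r)) := by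
      simp only [hΨ, ← Finset.sum_sub_distrib, ← mul_sub]
      rw [Finset.sum_comm]
      simp only [← Finset.mul_sum]
      refine (Finset.sum_le_sum fun v hv => ?_).trans (Finset.sum_le_sum_of_subset_of_nonneg
        (Finset.subset_univ G') fun v _ _ => mul_nonneg (hc v) (Finset.sum_nonneg fun r _ =>
          sub_nonneg.2 (vertexPotential_mono P Finset.sdiff_subset v)))
      obtain ⟨hvG, hlv, hgood⟩ := Finset.mem_filter.1 hv
      refine le_mul_of_one_le_right (hc v) (one_le_sum_vertexPotential_sub h.admissible
        (distTo_le ..) hlv (hfar v) (fun r _ => ?_) hgood)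
      have hvr := (hG v hvG).1
      refine le_card_filter_farSet h.admissible.κ_pos hwK h.admissible.le_δ hH hvr
        (fun hn => (hG v hvG).2 ((hZ v).2 ⟨hn, hvr⟩)) (fun u hu hu' => ?_) r
      exact distTo_eq_zero _ ((hZ u).2 ⟨hu, hu'⟩)
    obtain ⟨r, hr, hcost⟩ := Finset.exists_le_of_sum_le (s := range (R + P.θ))
      ⟨0, Finset.mem_range.2 (by omega)⟩ (f := cost)
      (g := fun r => 2 * (16 * P.δ) * (harmonic P.K : ℝ) *
        (Ψ H - Ψ (H \ N.levelCut H lam r))) (by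
        rw [← Finset.mul_sum]
        refine hc2.trans ?_
        have h1 : ∑ v ∈ G, (cP v + cM v) ≤
          2 * ∑ r ∈ range (R + P.θ), (Ψ H - Ψ (H \ N.levelCut H lam r)) := by linarith
        calc _ ≤ 16 * (P.δ : ℝ) * (harmonic P.K : ℝ) *
            (2 * ∑ r ∈ range (R + P.θ), (Ψ H - Ψ (H \ N.levelCut H lam r))) := by gcongr
          _ = _ := by ring)
    rw [Finset.mem_range] at hr
    have hcard := card_reachPairs_sdiff_lt (F := N.levelCut H lam r) hxy
      (not_reach_of_levelCut (by omega) (by omega))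
    refine ⟨_, _, hc1 r, hcost.trans ?_, by omega⟩
    have h2 : 16 * (harmonic P.K : ℝ) * (∑ v, (cP v + cM v)) *
        (N.reachPairs (H \ N.levelCut H lam r)).card / P.B ≤
        16 * (harmonic P.K : ℝ) * (∑ v, (cP v + cM v)) * (N.reachPairs H).card / P.B := by
      have h3 : 0 ≤ ∑ v, (cP v + cM v) := Finset.sum_nonneg fun v _ => hc v
      have h4 : (N.reachPairs (H \ N.levelCut H lam r)).card ≤ (N.reachPairs H).card := by omega
      gcongr
    unfold potential
    simp only [hΨ]
    linarith

/-- A cheap cut exists after `j` more rounds. -/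
theorem hasCheapCut_of_partialLen (h : N.IsGrowable E₀ α β cP cM P m D s t) (hH : H ⊆ E₀)
    (hfar : ∀ v, (N.farPairs E₀ (fun e => α e + β e) P.δ H v).card ≤ P.B) {x y : V}
    (hxy : N.Reach H x y) {Z : V → Prop}
    (hZ : ∀ z, Z z ↔ N.Near E₀ (fun e => α e + β e) (4 * P.δ) z y ∧ N.Reach H z y) (j : ℕ)
    {G : Finset V} (hG : ∀ v ∈ G, N.Reach H v y ∧ ¬ Z v)
    (hlen : ∀ z p, Z z → N.WalkIn H x z p →
      8 * P.δ + j * P.θ ≤ (p.map (N.partialLen α β G)).sum)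
    (hcost : 2 ^ m * ∑ v ∈ G, (cP v + cM v) ≤ 2 ^ j * ∑ v, (cP v + cM v)) :
    N.HasCheapCut E₀ (fun e => α e + β e) (fun v => cP v + cM v) P H := by
  have hδ := h.admissible.δ_pos
  induction j generalizing G with
  | zero =>
    set lam := N.distTo H (N.partialLen α β G) Z (8 * P.δ) with hlam
    have hZy : Z y := (hZ y).2 ⟨Near.refl _ _ _ _, Reach.refl _ _⟩
    have hx : lam x = 8 * P.δ := by
      rcases distTo_cases (N := N) H (N.partialLen α β G) Z (8 * P.δ) x with
        h1 | ⟨z, p, h1, h2, h3⟩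
      · exact h1
      · have := hlen z p h1 h2
        exact le_antisymm (distTo_le ..) (le_trans (by omega) h3.symm.le)
    have hy : lam y = 0 := distTo_eq_zero _ hZy
    obtain ⟨cost, hc1, hc2⟩ := h.leveled.exists_levelCut_cost hH lam G (fun e he => by
      exact distTo_tail_le he) (8 * P.δ)
    obtain ⟨r, hr, hr'⟩ := Finset.exists_le_of_sum_le (s := range (8 * P.δ))
      ⟨0, Finset.mem_range.2 (by omega)⟩ (f := cost)
      (g := fun r => 2 * (harmonic P.K : ℝ) * ∑ v ∈ G, (cP v + cM v)) (by
        rw [Finset.sum_const, Finset.card_range, nsmul_eq_mul]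
        push_cast
        linarith)
    rw [Finset.mem_range] at hr
    have hHc := harmonic_cast_nonneg P.K
    have hB : (0 : ℝ) < P.B := by exact_mod_cast h.admissible.B_pos
    have hBm : (P.B : ℝ) ≤ 2 ^ m := by exact_mod_cast h.B_le
    have hc : ∀ v, 0 ≤ cP v + cM v := fun v =>
      add_nonneg (h.leveled.cP_nonneg v) (h.leveled.cM_nonneg v)
    have hsG : 0 ≤ ∑ v ∈ G, (cP v + cM v) := Finset.sum_nonneg fun v _ => hc v
    refine hasCheapCut_of_card hc h.admissible.B_pos one_pos (hc1 r) (card_reachPairs_sdiff_lt hxy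
      (not_reach_of_levelCut (by omega) (by omega))) (hr'.trans ?_)
    rw [le_div_iff₀ hB]
    have h1 : (∑ v ∈ G, (cP v + cM v)) * P.B ≤ ∑ v, (cP v + cM v) := by nlinarith
    have h2 : 0 ≤ ∑ v, (cP v + cM v) := Finset.sum_nonneg fun v _ => hc v
    have h3 := mul_le_mul_of_nonneg_left h1 hHc
    have h4 := mul_nonneg hHc h2
    push_cast
    linarith
  | succ j ih =>
    rcases h.hasCheapCut_or_halve hH hfar hxy hZ hG (R := 8 * P.δ + j * P.θ) (by omega)
      (fun z p hz hp => by
        have := hlen z p hz hp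
        rw [Nat.add_one_mul j] at this
        omega) with h1 | ⟨G', hG', h1, h2⟩
    · exact h1
    · refine ih (fun v hv => hG v (hG' hv)) h2 ?_
      rw [pow_succ] at hcost
      have : (0 : ℝ) < 2 ^ m := by positivity
      nlinarith

theorem hasCheapCut (h : N.IsGrowable E₀ α β cP cM P m D s t) (hH : H ⊆ E₀) {i : ι}
    (hi : N.Reach H (s i) (t i)) :
    N.HasCheapCut E₀ (fun e => α e + β e) (fun v => cP v + cM v) P H := by
  by_cases hfar : ∀ v, (N.farPairs E₀ (fun e => α e + β e) P.δ H v).card ≤ P.B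
  · refine h.hasCheapCut_of_partialLen hH hfar hi (Z := fun z =>
      N.Near E₀ (fun e => α e + β e) (4 * P.δ) z (t i) ∧ N.Reach H z (t i)) (fun z => Iff.rfl) m
      (G := univ.filter fun v => N.Reach H v (t i) ∧
        ¬ (N.Near E₀ (fun e => α e + β e) (4 * P.δ) v (t i) ∧ N.Reach H v (t i)))
      (fun v hv => (Finset.mem_filter.1 hv).2) (fun z p hz hp => ?_) ?_
    · obtain ⟨y, q, hy, hq, hs⟩ := exists_walkIn_sum_le (α := α)
        (fun e he => h.leveled.le_head e (hH he))
        (Z := fun z => N.Near E₀ (fun e => α e + β e) (4 * P.δ) z (t i) ∧ N.Reach H z (t i))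
        (fun z hz => hz.2) (G := univ.filter fun v => N.Reach H v (t i) ∧
          ¬ (N.Near E₀ (fun e => α e + β e) (4 * P.δ) v (t i) ∧ N.Reach H v (t i)))
        (fun v hv hv' => Finset.mem_filter.2 ⟨Finset.mem_univ v, hv, hv'⟩) hp hz
      obtain ⟨⟨q', hq', hs'⟩, -⟩ := hy
      have h1 := h.le_sum i (q ++ q') ((hq.mono hH).append hq')
      have h2 := h.le_D
      rw [List.map_append, List.sum_append] at h1
      split_ifs at hs <;> omega
    · refine mul_le_mul_of_nonneg_left (Finset.sum_le_sum_of_subset_of_nonneg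
        (Finset.subset_univ _) fun v _ _ =>
        add_nonneg (h.leveled.cP_nonneg v) (h.leveled.cM_nonneg v)) (by positivity)
  · push Not at hfar
    obtain ⟨v, hv⟩ := hfar
    exact h.hasCheapCut_of_farPairs hH hv

theorem potential_nonneg (h : N.IsGrowable E₀ α β cP cM P m D s t) (H : Finset E) :
    0 ≤ N.potential E₀ (fun e => α e + β e) (fun v => cP v + cM v) P H := by
  have hc : ∀ v, 0 ≤ cP v + cM v := fun v =>
    add_nonneg (h.leveled.cP_nonneg v) (h.leveled.cM_nonneg v)
  have h1 := harmonic_cast_nonneg P.K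
  have h2 : 0 ≤ ∑ v, (cP v + cM v) := Finset.sum_nonneg fun v _ => hc v
  have h3 : 0 ≤ ∑ v, (cP v + cM v) * N.vertexPotential E₀ (fun e => α e + β e) P H v :=
    Finset.sum_nonneg fun v _ => mul_nonneg (hc v) (vertexPotential_nonneg P H v)
  unfold potential
  positivity

/-- The region growing procedure separates all pairs at a cost bounded by the potential. -/
theorem exists_cheap (h : N.IsGrowable E₀ α β cP cM P m D s t) (hH : H ⊆ E₀) :
    ∃ F, N.Cheap F (N.potential E₀ (fun e => α e + β e) (fun v => cP v + cM v) P H) ∧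
      ∀ i, ¬ N.Reach (H \ F) (s i) (t i) := by
  induction hn : (N.reachPairs H).card using Nat.strong_induction_on generalizing H with
  | _ n ih =>
    by_cases hi : ∃ i, N.Reach H (s i) (t i)
    · obtain ⟨i, hi⟩ := hi
      obtain ⟨F, x, hF, hx, hlt⟩ := h.hasCheapCut hH hi
      obtain ⟨F', hF', hsep⟩ := ih _ (hn ▸ hlt) (Finset.sdiff_subset.trans hH) rfl
      refine ⟨F ∪ F', (hF.union hF').mono (by linarith), fun i hi => hsep i ?_⟩
      rwa [sdiff_sdiff_left]
    · push Not at hi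
      refine ⟨∅, Cheap.empty.mono (h.potential_nonneg H), fun i hi' => hi i ?_⟩
      rwa [Finset.sdiff_empty] at hi'

end IsGrowable

end Growth

end DirPolyNet

theorem nonpos_of_forall_mul_le {x c M : ℝ} (h : ∀ r : ℝ, 0 ≤ r → c + r * x ≤ M) : x ≤ 0 := by
  by_contra hx
  push Not at hx
  have h1 := h (|M - c| / x + 1) (by positivity)
  rw [add_mul, div_mul_cancel₀ _ hx.ne', one_mul] at h1
  have := le_abs_self (M - c)
  linarith

/-- Strong duality for packing linear programs. -/
theorem exists_dual_of_packing {P J : Type} [Fintype P] [Fintype J] (A : J → P → ℝ) (cap : J → ℝ)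
    (hcap : ∀ j, 0 < cap j) (b : ℝ)
    (hb : ∀ f : P → ℝ, (∀ p, 0 ≤ f p) → (∀ j, ∑ p, A j p * f p ≤ cap j) → ∑ p, f p ≤ b) :
    ∃ y : J → ℝ, (∀ j, 0 ≤ y j) ∧ ∑ j, y j * cap j ≤ b ∧ ∀ p, 1 ≤ ∑ j, A j p * y j := by
  set C : Set ((J → ℝ) × ℝ) := {q | ∃ f : P → ℝ, (∀ p, 0 ≤ f p) ∧
    (∀ j, ∑ p, A j p * f p < q.1 j) ∧ q.2 < ∑ p, f p} with hC
  have hopen : IsOpen C := by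
    have : C = ⋃ f ∈ {f : P → ℝ | ∀ p, 0 ≤ f p}, {q : (J → ℝ) × ℝ |
        (∀ j, ∑ p, A j p * f p < q.1 j) ∧ q.2 < ∑ p, f p} := by
      ext q
      simp only [hC, Set.mem_iUnion, Set.mem_ofPred_eq, exists_prop]
    rw [this]
    refine isOpen_biUnion fun f _ => IsOpen.and ?_ ?_
    · simp only [Set.ofPred_forall]
      exact isOpen_iInter_of_finite fun j => isOpen_lt (by fun_prop) (by fun_prop)
    · exact isOpen_lt (by fun_prop) (by fun_prop)
  have hconv : Convex ℝ C := by
    rintro q ⟨f, hf, hf1, hf2⟩ q' ⟨g, hg, hg1, hg2⟩ a c ha hc hac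
    refine ⟨fun p => a * f p + c * g p, fun p => ?_, fun j => ?_, ?_⟩
    · have := hf p
      have := hg p
      positivity
    · have h1 := hf1 j
      have h2 := hg1 j
      have h3 : ∑ p, A j p * (a * f p + c * g p) =
          a * ∑ p, A j p * f p + c * ∑ p, A j p * g p := by
        rw [Finset.mul_sum, Finset.mul_sum, ← Finset.sum_add_distrib]
        exact Finset.sum_congr rfl fun p _ => by ring
      rw [h3]
      simp only [Prod.fst_add, Prod.smul_fst, Pi.add_apply, Pi.smul_apply, smul_eq_mul]
      rcases ha.eq_or_lt with rfl | ha
      · obtain rfl : c = 1 := by linarith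
        linarith
      · nlinarith
    · rw [Finset.sum_add_distrib, ← Finset.mul_sum, ← Finset.mul_sum]
      simp only [Prod.snd_add, Prod.smul_snd, smul_eq_mul]
      rcases ha.eq_or_lt with rfl | ha
      · obtain rfl : c = 1 := by linarith
        linarith
      · nlinarith
  have hnot : (cap, b) ∉ C := by
    rintro ⟨f, hf, hf1, hf2⟩
    exact absurd (hb f hf fun j => (hf1 j).le) (not_le.2 hf2)
  obtain ⟨φ, hφ⟩ := geometric_hahn_banach_open_point hconv hopen hnot
  set u : J → ℝ := fun j => φ (Pi.single j 1, 0) with hu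
  set θ : ℝ := φ (0, 1) with hθ
  have hval : ∀ z ω, φ (z, ω) = ∑ j, z j * u j + ω * θ := by
    intro z ω
    have h1 : ((z, ω) : (J → ℝ) × ℝ) =
        (∑ j, z j • ((Pi.single j 1, 0) : (J → ℝ) × ℝ)) + ω • ((0, 1) : (J → ℝ) × ℝ) := by
      ext j
      · simp [Prod.fst_sum, Finset.sum_apply, Pi.single_apply]
      · simp [Prod.snd_sum]
    rw [h1, map_add, map_sum, map_smul, smul_eq_mul]
    simp only [map_smul, smul_eq_mul, hu, hθ]
  set M := φ (cap, b) with hM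
  have hle : ∀ f : P → ℝ, (∀ p, 0 ≤ f p) →
      ∑ j, (∑ p, A j p * f p) * u j + (∑ p, f p) * θ ≤ M := by
    intro f hf
    refine le_of_forall_pos_le_add fun ε hε => ?_
    set η := ε / (|∑ j, u j - θ| + 1) with hη
    have hη0 : 0 < η := by positivity
    have h1 := hφ (fun j => ∑ p, A j p * f p + η, ∑ p, f p - η)
      ⟨f, hf, fun j => by simp only; linarith, by simp only; linarith⟩
    rw [hval] at h1
    simp only [add_mul, sub_mul, Finset.sum_add_distrib, ← Finset.mul_sum] at h1
    have h2 : η * (|∑ j, u j - θ| + 1) = ε := div_mul_cancel₀ _ (by positivity)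
    have h3 := mul_le_mul_of_nonneg_left (neg_abs_le (∑ j, u j - θ)) hη0.le
    nlinarith
  have hu0 : ∀ j, u j ≤ 0 := by
    intro j
    refine nonpos_of_forall_mul_le (c := ∑ j, u j - θ) (M := M) fun r hr => ?_
    have h1 := hφ (fun i => 1 + Pi.single (M := fun _ => ℝ) j r i, -1)
      ⟨0, fun p => le_rfl, fun i => ?_, by simp⟩
    · rw [hval] at h1
      simp only [add_mul, Finset.sum_add_distrib, Pi.single_apply, ite_mul, zero_mul,
        Finset.sum_ite_eq', Finset.mem_univ, if_true, one_mul] at h1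
      linarith
    · simp only [Pi.zero_apply, mul_zero, Finset.sum_const_zero, Pi.single_apply]
      split_ifs <;> linarith
  have hθ0 : 0 ≤ θ := by
    refine neg_nonpos.1 (nonpos_of_forall_mul_le (c := ∑ j, u j - θ) (M := M) fun r hr => ?_)
    have h1 := hφ (fun i => 1, -1 - r) ⟨0, fun p => le_rfl, fun i => by simp, by simp; linarith⟩
    rw [hval] at h1
    simp only [one_mul] at h1
    linarith
  have hM0 : 0 ≤ M := by
    have := hle 0 fun p => le_rfl
    simpa using this
  have hMval : M = ∑ j, cap j * u j + b * θ := hval cap b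
  have hθpos : 0 < θ := by
    refine hθ0.lt_of_ne fun h0 => ?_
    rw [← h0, mul_zero, add_zero] at hMval
    have h1 : ∀ j ∈ univ, cap j * u j = 0 := by
      rw [← Finset.sum_eq_zero_iff_of_nonpos fun j _ =>
        mul_nonpos_of_nonneg_of_nonpos (hcap j).le (hu0 j)]
      exact le_antisymm (Finset.sum_nonpos fun j _ =>
        mul_nonpos_of_nonneg_of_nonpos (hcap j).le (hu0 j)) (hMval ▸ hM0)
    have h2 : ∀ j, u j = 0 := fun j =>
      (mul_eq_zero.1 (h1 j (Finset.mem_univ j))).resolve_left (hcap j).ne'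
    have h3 := hφ (fun i => 1, -1) ⟨0, fun p => le_rfl, fun i => by simp, by simp⟩
    rw [hval, hMval] at h3
    simp [h2, ← h0] at h3
  refine ⟨fun j => -u j / θ, fun j => div_nonneg (by linarith [hu0 j]) hθ0, ?_, fun p => ?_⟩
  · have h1 : ∑ j, -u j / θ * cap j = -(∑ j, cap j * u j) / θ := by
      rw [← Finset.sum_neg_distrib, Finset.sum_div]
      exact Finset.sum_congr rfl fun j _ => by ring
    rw [h1, div_le_iff₀ hθpos]
    linarith
  · have h1 : ∑ j, A j p * u j + θ ≤ 0 := by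
      refine nonpos_of_forall_mul_le (c := 0) (M := M) fun r hr => ?_
      have h2 := hle (Pi.single p r) fun q => by
        rw [Pi.single_apply]; split_ifs <;> linarith
      simp only [Pi.single_apply, mul_ite, mul_zero, Finset.sum_ite_eq',
        Finset.mem_univ, if_true] at h2
      have h3 : ∑ j, A j p * r * u j = r * ∑ j, A j p * u j := by
        rw [Finset.mul_sum]
        exact Finset.sum_congr rfl fun j _ => by ring
      linarith
    have h2 : ∑ j, A j p * (-u j / θ) = -(∑ j, A j p * u j) / θ := by
      rw [← Finset.sum_neg_distrib, Finset.sum_div]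
      exact Finset.sum_congr rfl fun j _ => by ring
    rw [h2, le_div_iff₀ hθpos]
    linarith

/-- `ρ` is a polymatroid on the ground set `U`. -/
structure IsPolymatroidOn {E : Type} [DecidableEq E] (ρ : Finset E → ℝ) (U : Finset E) : Prop where
  empty : ρ ∅ = 0
  nonneg : ∀ A ⊆ U, 0 ≤ ρ A
  mono : ∀ A B, A ⊆ B → B ⊆ U → ρ A ≤ ρ B
  submod : ∀ A B, A ⊆ U → B ⊆ U → ρ (A ∪ B) + ρ (A ∩ B) ≤ ρ A + ρ B

/-- If the sets `S j` with weights `y j` cover every element of `T` with weight at least `τ`, then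
the weighted sum of the `ρ (S j)` is at least `τ * ρ T`. -/
theorem IsPolymatroidOn.mul_le_sum {E J : Type} [DecidableEq E] [Fintype J] {ρ : Finset E → ℝ}
    {U : Finset E} (h : IsPolymatroidOn ρ U) {S : J → Finset E} (hS : ∀ j, S j ⊆ U) {y : J → ℝ}
    (hy : ∀ j, 0 ≤ y j) {τ : ℝ} {T : Finset E} (hT : T ⊆ U)
    (hτ : ∀ e ∈ T, τ ≤ ∑ j, if e ∈ S j then y j else 0) : τ * ρ T ≤ ∑ j, y j * ρ (S j) := by
  suffices hmain : τ * ρ T ≤ ∑ j, y j * ρ (S j ∩ T) from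
    hmain.trans (Finset.sum_le_sum fun j _ =>
      mul_le_mul_of_nonneg_left (h.mono _ _ Finset.inter_subset_left (hS j)) (hy j))
  induction T using Finset.induction_on with
  | empty => simp [h.empty]
  | insert e T he ih =>
    have hTU : T ⊆ U := (Finset.subset_insert e T).trans hT
    have h1 := ih hTU fun d hd => hτ d (Finset.mem_insert_of_mem hd)
    have h2 := hτ e (Finset.mem_insert_self e T)
    have h3 := h.mono T (insert e T) (Finset.subset_insert e T) hT
    have h4 : (∑ j, if e ∈ S j then y j else 0) * (ρ (insert e T) - ρ T) ≤
        ∑ j, y j * (ρ (S j ∩ insert e T) - ρ (S j ∩ T)) := by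
      rw [Finset.sum_mul]
      refine Finset.sum_le_sum fun j _ => ?_
      by_cases hj : e ∈ S j
      · rw [if_pos hj]
        refine mul_le_mul_of_nonneg_left ?_ (hy j)
        have h5 := h.submod T (S j ∩ insert e T) hTU (Finset.inter_subset_left.trans (hS j))
        have h6 : T ∪ S j ∩ insert e T = insert e T := by
          ext d; simp only [Finset.mem_union, Finset.mem_inter, Finset.mem_insert]
          by_cases hd : d = e
          · subst hd; simp [hj]
          · simp only [hd, false_or]; tauto
        have h7 : T ∩ (S j ∩ insert e T) = S j ∩ T := by
          ext d; simp only [Finset.mem_inter, Finset.mem_insert]; tauto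
        rw [h6, h7] at h5
        linarith
      · rw [if_neg hj, zero_mul, Finset.inter_insert_of_notMem hj, sub_self, mul_zero]
    have h5 := mul_le_mul_of_nonneg_right h2 (sub_nonneg.2 h3)
    simp only [mul_sub, Finset.sum_sub_distrib] at h4 h5
    linarith

/-- The indices of the nontrivial constraints of a family of polymatroids. -/
def ConstraintIndex {V E : Type} (ρ : V → Finset E → ℝ) (U : V → Finset E) : Type :=
  {j : V × Finset E // j.2 ⊆ U j.1 ∧ 0 < ρ j.1 j.2}

noncomputable instance {V E : Type} [Fintype V] [Fintype E] (ρ : V → Finset E → ℝ)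
    (U : V → Finset E) : Fintype (ConstraintIndex ρ U) :=
  Fintype.ofInjective Subtype.val Subtype.val_injective

/-- The total weight of the sets containing `e`. -/
noncomputable def coverWeight {V E : Type} [Fintype V] [Fintype E] [DecidableEq E]
    {ρ : V → Finset E → ℝ} {U : V → Finset E} (y : ConstraintIndex ρ U → ℝ) (e : E) : ℝ :=
  ∑ j : ConstraintIndex ρ U, if e ∈ j.1.2 then y j else 0

/-- The contribution of the vertex `v` to the dual objective. -/
noncomputable def coverCost {V E : Type} [Fintype V] [Fintype E] [DecidableEq V]
    {ρ : V → Finset E → ℝ} {U : V → Finset E} (y : ConstraintIndex ρ U → ℝ) (v : V) : ℝ :=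
  ∑ j : ConstraintIndex ρ U, if j.1.1 = v then y j * ρ j.1.1 j.1.2 else 0

section Cover

variable {V E : Type} [Fintype V] [Fintype E] [DecidableEq V] [DecidableEq E]
  {ρ : V → Finset E → ℝ} {U : V → Finset E} {y : ConstraintIndex ρ U → ℝ}

omit [DecidableEq E] in
theorem sum_coverCost : ∑ v, coverCost y v = ∑ j, y j * ρ j.1.1 j.1.2 := by
  unfold coverCost
  rw [Finset.sum_comm]
  simp

omit [DecidableEq V] in
theorem coverWeight_nonneg (hy : ∀ j, 0 ≤ y j) (e : E) : 0 ≤ coverWeight y e :=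
  Finset.sum_nonneg fun j _ => by split_ifs <;> simp [hy j]

omit [DecidableEq E] in
theorem coverCost_nonneg (hy : ∀ j, 0 ≤ y j) (v : V) : 0 ≤ coverCost y v :=
  Finset.sum_nonneg fun j _ => by
    split_ifs
    · exact mul_nonneg (hy j) j.2.2.le
    · exact le_rfl

theorem mul_le_coverCost (hU : ∀ e v v', e ∈ U v → e ∈ U v' → v = v')
    (hρ : ∀ v, IsPolymatroidOn (ρ v) (U v)) (hy : ∀ j, 0 ≤ y j) {v : V} {τ : ℝ} {T : Finset E}
    (hT : T ⊆ U v) (hτ : ∀ e ∈ T, τ ≤ coverWeight y e) : τ * ρ v T ≤ coverCost y v := by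
  have h1 : ∀ j : ConstraintIndex ρ U, (if j.1.1 = v then j.1.2 else ∅) ⊆ U v := fun j => by
    split_ifs with h
    · exact h ▸ j.2.1
    · exact Finset.empty_subset _
  have h2 : ∀ j : ConstraintIndex ρ U, 0 ≤ if j.1.1 = v then y j else 0 := fun j => by
    split_ifs <;> simp [hy j]
  have h3 : ∀ e ∈ T, τ ≤ ∑ j : ConstraintIndex ρ U,
      if e ∈ (if j.1.1 = v then j.1.2 else ∅) then (if j.1.1 = v then y j else 0) else 0 := by
    intro e he
    refine (hτ e he).trans (Finset.sum_le_sum fun j _ => ?_)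
    by_cases hj : e ∈ j.1.2
    · have := hU e _ _ (j.2.1 hj) (hT he)
      simp [hj, this]
    · rw [if_neg hj]
      have := h2 j
      split_ifs at this ⊢ <;> simp
  refine ((hρ v).mul_le_sum h1 h2 hT h3).trans (Finset.sum_le_sum fun j _ => ?_)
  by_cases hj : j.1.1 = v <;> simp [hj]

omit [DecidableEq V] in
theorem sum_mul_coverWeight (D : Finset E) :
    ∑ j : ConstraintIndex ρ U, ((j.1.2 ∩ D).card : ℝ) * y j = ∑ e ∈ D, coverWeight y e := by
  unfold coverWeight
  rw [Finset.sum_comm]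
  refine Finset.sum_congr rfl fun j _ => ?_
  rw [← Finset.sum_filter, Finset.sum_const, nsmul_eq_mul, Finset.filter_mem_eq_inter,
    Finset.inter_comm]

end Cover

theorem exists_dual_of_packing_pair {P J₁ J₂ : Type} [Fintype P] [Fintype J₁] [Fintype J₂]
    (A₁ : J₁ → P → ℝ) (A₂ : J₂ → P → ℝ) (cap₁ : J₁ → ℝ) (cap₂ : J₂ → ℝ) (hcap₁ : ∀ j, 0 < cap₁ j)
    (hcap₂ : ∀ j, 0 < cap₂ j) (b : ℝ)
    (hb : ∀ f : P → ℝ, (∀ p, 0 ≤ f p) → (∀ j, ∑ p, A₁ j p * f p ≤ cap₁ j) →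
      (∀ j, ∑ p, A₂ j p * f p ≤ cap₂ j) → ∑ p, f p ≤ b) :
    ∃ (y : J₁ → ℝ) (z : J₂ → ℝ), (∀ j, 0 ≤ y j) ∧ (∀ j, 0 ≤ z j) ∧
      ∑ j, y j * cap₁ j + ∑ j, z j * cap₂ j ≤ b ∧
      ∀ p, 1 ≤ ∑ j, A₁ j p * y j + ∑ j, A₂ j p * z j := by
  obtain ⟨y, hy, hyb, hyp⟩ := exists_dual_of_packing (Sum.elim A₁ A₂) (Sum.elim cap₁ cap₂)
    (by rintro (j | j); exacts [hcap₁ j, hcap₂ j]) b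
    (fun f hf h => hb f hf (fun j => h (Sum.inl j)) fun j => h (Sum.inr j))
  simp only [Fintype.sum_sum_type, Sum.elim_inl, Sum.elim_inr] at hyb hyp
  exact ⟨fun j => y (Sum.inl j), fun j => y (Sum.inr j), fun j => hy _, fun j => hy _, hyb, hyp⟩

theorem IsPolymatroidOn.nonpos_of_singleton {E : Type} [DecidableEq E] {ρ : Finset E → ℝ}
    {U T : Finset E} (h : IsPolymatroidOn ρ U) (hT : T ⊆ U) (h0 : ∀ e ∈ T, ρ {e} ≤ 0) :
    ρ T ≤ 0 := by
  induction T using Finset.induction_on with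
  | empty => exact h.empty.le
  | insert e T he ih =>
    have hTU : T ⊆ U := (Finset.subset_insert e T).trans hT
    have heU : {e} ⊆ U := Finset.singleton_subset_iff.2 (hT (Finset.mem_insert_self e T))
    have h1 := ih hTU fun d hd => h0 d (Finset.mem_insert_of_mem hd)
    have h2 := h0 e (Finset.mem_insert_self e T)
    have h3 := h.submod {e} T heU hTU
    have h4 := h.nonneg ({e} ∩ T) (Finset.inter_subset_left.trans heU)
    rw [← Finset.insert_eq] at h3
    linarith

theorem finsum_mem_list_eq_sum {E : Type} [DecidableEq E] {f : List E → ℝ} {T : Finset (List E)}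
    (hT : Function.support f ⊆ T) (e : E) :
    ∑ᶠ p ∈ {p : List E | e ∈ p}, f p = ∑ p ∈ T, if e ∈ p then f p else 0 := by
  rw [finsum_mem_def, finsum_eq_sum_of_support_subset]
  · exact Finset.sum_congr rfl fun p _ => by simp [Set.indicator_apply]
  · exact fun p hp => hT fun h0 => hp (by simp [Set.indicator_apply, h0])

namespace DirPolyNet

section Flows

variable {V E : Type} [Fintype V] [Fintype E] [DecidableEq V] [DecidableEq E]
  (N : DirPolyNet V E) {ι : Type} [Fintype ι] {s t : ι → V}

theorem isPolymatroidOn_rhoP (v : V) : IsPolymatroidOn (N.rhoP v) (N.outE v) :=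
  ⟨N.rhoP_empty v, N.rhoP_nonneg v, N.rhoP_mono v, N.rhoP_submod v⟩

theorem isPolymatroidOn_rhoM (v : V) : IsPolymatroidOn (N.rhoM v) (N.inE v) :=
  ⟨N.rhoM_empty v, N.rhoM_nonneg v, N.rhoM_mono v, N.rhoM_submod v⟩

/-- The edges which can be cut for free. -/
noncomputable def freeEdges : Finset E :=
  univ.filter fun e => N.tail e ≠ N.head e ∧
    (N.rhoP (N.tail e) {e} ≤ 0 ∨ N.rhoM (N.head e) {e} ≤ 0)

theorem cheap_freeEdges : N.Cheap N.freeEdges 0 := by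
  refine ⟨fun e he => (Finset.mem_filter.1 he).2.1, univ.filter fun e => N.rhoP (N.tail e) {e} ≤ 0,
    univ.filter fun e => N.rhoM (N.head e) {e} ≤ 0, fun e he => ?_,
    Finset.sum_nonpos fun v _ => add_nonpos ?_ ?_⟩
  · simpa using (Finset.mem_filter.1 he).2.2
  · refine (N.isPolymatroidOn_rhoP v).nonpos_of_singleton Finset.inter_subset_left fun e he => ?_
    simp only [outE, Finset.mem_inter, Finset.mem_filter, Finset.mem_univ, true_and] at he
    exact he.1 ▸ he.2
  · refine (N.isPolymatroidOn_rhoM v).nonpos_of_singleton Finset.inter_subset_left fun e he => ?_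
    simp only [inE, Finset.mem_inter, Finset.mem_filter, Finset.mem_univ, true_and] at he
    exact he.1 ▸ he.2

theorem finite_setOf_isPath (x y : V) : {p | N.IsPath x y p}.Finite :=
  (List.finite_length_lt E (Fintype.card V)).subset fun _ hp => IsPath.length_lt hp

theorem IsPath.nodup {N : DirPolyNet V E} {x y : V} {p : List E} (h : N.IsPath x y p) :
    p.Nodup := by
  induction p generalizing x with
  | nil => exact List.nodup_nil
  | cons e p ih =>
    obtain ⟨⟨rfl, hw⟩, hn⟩ := h
    simp only [walkVerts, List.nodup_cons] at hn
    refine List.nodup_cons.2 ⟨fun he => hn.1 ?_, ih ⟨hw, hn.2⟩⟩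
    obtain ⟨p₁, p₂, rfl⟩ := List.append_of_mem he
    obtain ⟨z, h1, h2⟩ := N.isWalk_append.1 hw
    obtain rfl : N.tail e = z := h2.1
    exact (N.walkVerts_suffix h1).subset (N.mem_walkVerts_start _ _)

variable {N} in
theorem IsFlow.rate_le {f : ι → List E → ℝ} (hf : N.IsFlow s t f) (hst : ∀ i, s i ≠ t i) (i : ι) :
    rate f i ≤ N.rhoP (s i) (N.outE (s i)) := by
  refine le_trans ?_ (hf.capP (s i) _ subset_rfl)
  have h1 : rate f i = ∑ p ∈ (hf.fin i).toFinset, f i p :=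
    finsum_eq_sum_of_support_subset _ (by simp)
  have h2 : ∀ e, ∑ p ∈ (hf.fin i).toFinset, (if e ∈ p then f i p else 0) ≤ N.edgeFlow f e := by
    intro e
    rw [← finsum_mem_list_eq_sum (f := f i) (T := (hf.fin i).toFinset) (by simp)]
    exact Finset.single_le_sum (f := fun i => ∑ᶠ p ∈ {p : List E | e ∈ p}, f i p)
      (fun j _ => finsum_nonneg fun p => finsum_nonneg fun _ => hf.nonneg j p) (Finset.mem_univ i)
  rw [h1]
  refine le_trans ?_ (Finset.sum_le_sum fun e _ => h2 e)
  rw [Finset.sum_comm]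
  refine Finset.sum_le_sum fun p hp => ?_
  have hp' := hf.supp i p (by simpa using hp)
  cases p with
  | nil => exact absurd hp'.1 (hst i)
  | cons e p =>
    have he : e ∈ N.outE (s i) := by
      simpa [outE] using hp'.1.1
    refine le_trans (by simp) (Finset.single_le_sum
      (f := fun d => if d ∈ e :: p then f i (e :: p) else 0) (fun d _ => ?_) he)
    split_ifs
    · exact hf.nonneg i _
    · exact le_rfl

variable {N} in
theorem IsFlow.sum_rate_le_maxThroughput {f : ι → List E → ℝ} (hf : N.IsFlow s t f)
    (hst : ∀ i, s i ≠ t i) : ∑ i, rate f i ≤ N.maxThroughput s t := by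
  refine le_csSup ⟨∑ i, N.rhoP (s i) (N.outE (s i)), ?_⟩ ⟨f, hf, rfl⟩
  rintro _ ⟨g, hg, rfl⟩
  exact Finset.sum_le_sum fun i _ => hg.rate_le hst i

/-- Weights on simple paths satisfying the capacity constraints add up to at most the maximum
throughput. -/
theorem sum_le_maxThroughput (hst : ∀ i, s i ≠ t i) (Q : ι → Finset (List E))
    (hQ : ∀ i, ∀ p ∈ Q i, N.IsPath (s i) (t i) p ∧ ∀ e ∈ p, e ∉ N.freeEdges)
    (f : (Σ i, {p // p ∈ Q i}) → ℝ) (hf : ∀ q, 0 ≤ f q)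
    (hP : ∀ v S, S ⊆ N.outE v → 0 < N.rhoP v S →
      ∑ q, ((S ∩ q.2.1.toFinset).card : ℝ) * f q ≤ N.rhoP v S)
    (hM : ∀ v S, S ⊆ N.inE v → 0 < N.rhoM v S →
      ∑ q, ((S ∩ q.2.1.toFinset).card : ℝ) * f q ≤ N.rhoM v S) :
    ∑ q, f q ≤ N.maxThroughput s t := by
  set F : ι → List E → ℝ := fun i p => if h : p ∈ Q i then f ⟨i, p, h⟩ else 0 with hF
  have hFf : ∀ i (p : {p // p ∈ Q i}), F i p.1 = f ⟨i, p⟩ := fun i p => by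
    simp only [hF]; rw [dif_pos p.2]
  have hsupp : ∀ i, Function.support (F i) ⊆ (Q i : Set (List E)) := by
    intro i p hp
    by_contra hn
    exact hp (dif_neg hn)
  have hedge : ∀ e, N.edgeFlow F e = ∑ q, if e ∈ q.2.1 then f q else 0 := by
    intro e
    unfold edgeFlow
    rw [Fintype.sum_sigma]
    refine Finset.sum_congr rfl fun i _ => ?_
    rw [finsum_mem_list_eq_sum (hsupp i), ← Finset.sum_coe_sort]
    exact Finset.sum_congr rfl fun p _ => by simp only [hFf]
  have hsum : ∀ S : Finset E, ∑ e ∈ S, N.edgeFlow F e =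
      ∑ q, ((S ∩ q.2.1.toFinset).card : ℝ) * f q := by
    intro S
    simp only [hedge]
    rw [Finset.sum_comm]
    refine Finset.sum_congr rfl fun q _ => ?_
    rw [← Finset.sum_filter, Finset.sum_const, nsmul_eq_mul]
    congr 3
    ext e
    simp
  have hflow : N.IsFlow s t F := by
    refine ⟨fun i p => ?_, fun i p hp => ?_, fun i => (Q i).finite_toSet.subset (hsupp i),
      fun v S hS => ?_, fun v S hS => ?_⟩
    · simp only [hF]
      split_ifs
      · exact hf _
      · exact le_rfl
    · exact (hQ i p (hsupp i hp)).1
    · rw [hsum]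
      rcases ((N.isPolymatroidOn_rhoM v).nonneg S hS).lt_or_eq with h | h
      · exact hM v S hS h
      · rw [← h]
        refine Finset.sum_nonpos fun q _ => ?_
        rw [Finset.card_eq_zero.2, Nat.cast_zero, zero_mul]
        refine Finset.disjoint_iff_inter_eq_empty.1 (Finset.disjoint_left.2 fun e he he' => ?_)
        rw [List.mem_toFinset] at he'
        obtain ⟨h1, h2⟩ := hQ q.1 q.2.1 q.2.2
        refine h2 e he' (Finset.mem_filter.2 ⟨Finset.mem_univ _, h1.tail_ne_head he', Or.inr ?_⟩)
        have h3 : N.head e = v := (Finset.mem_filter.1 (hS he)).2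
        rw [h3, h]
        exact N.rhoM_mono v _ _ (Finset.singleton_subset_iff.2 he) hS
    · rw [hsum]
      rcases ((N.isPolymatroidOn_rhoP v).nonneg S hS).lt_or_eq with h | h
      · exact hP v S hS h
      · rw [← h]
        refine Finset.sum_nonpos fun q _ => ?_
        rw [Finset.card_eq_zero.2, Nat.cast_zero, zero_mul]
        refine Finset.disjoint_iff_inter_eq_empty.1 (Finset.disjoint_left.2 fun e he he' => ?_)
        rw [List.mem_toFinset] at he'
        obtain ⟨h1, h2⟩ := hQ q.1 q.2.1 q.2.2
        refine h2 e he' (Finset.mem_filter.2 ⟨Finset.mem_univ _, h1.tail_ne_head he', Or.inl ?_⟩)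
        have h3 : N.tail e = v := (Finset.mem_filter.1 (hS he)).2
        rw [h3, h]
        exact N.rhoP_mono v _ _ (Finset.singleton_subset_iff.2 he) hS
  refine le_trans (le_of_eq ?_) (hflow.sum_rate_le_maxThroughput hst)
  rw [Fintype.sum_sigma]
  refine Finset.sum_congr rfl fun i _ => ?_
  unfold rate
  rw [finsum_eq_sum_of_support_subset _ (hsupp i), ← Finset.sum_coe_sort (Q i) (F i)]
  exact Finset.sum_congr rfl fun p _ => (hFf i p).symm

/-- The dual solution of the maximum throughput problem, as lengths of half-edges. -/
theorem exists_fractional_cut (hst : ∀ i, s i ≠ t i) :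
    ∃ (a b : E → ℝ) (cP cM : V → ℝ), (∀ e, 0 ≤ a e) ∧ (∀ e, 0 ≤ b e) ∧ (∀ v, 0 ≤ cP v) ∧
      (∀ v, 0 ≤ cM v) ∧ ∑ v, (cP v + cM v) ≤ N.maxThroughput s t ∧
      (∀ v τ, ∀ T ⊆ N.outE v, (∀ e ∈ T, τ ≤ a e) → τ * N.rhoP v T ≤ cP v) ∧
      (∀ v τ, ∀ T ⊆ N.inE v, (∀ e ∈ T, τ ≤ b e) → τ * N.rhoM v T ≤ cM v) ∧
      ∀ i p, N.IsPath (s i) (t i) p → (∀ e ∈ p, e ∉ N.freeEdges) →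
        1 ≤ (p.map fun e => a e + b e).sum := by
  have hQ : ∀ i, ∃ Q : Finset (List E), ∀ p,
      p ∈ Q ↔ N.IsPath (s i) (t i) p ∧ ∀ e ∈ p, e ∉ N.freeEdges := by
    intro i
    refine ⟨(N.finite_setOf_isPath (s i) (t i)).toFinset.filter fun p => ∀ e ∈ p, e ∉ N.freeEdges,
      fun p => ?_⟩
    simp
  choose Q hQm using hQ
  obtain ⟨y, z, hy, hz, hyb, hyp⟩ := exists_dual_of_packing_pair
    (fun (j : ConstraintIndex N.rhoP N.outE) (q : Σ i, {p // p ∈ Q i}) =>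
      ((j.1.2 ∩ q.2.1.toFinset).card : ℝ))
    (fun (j : ConstraintIndex N.rhoM N.inE) (q : Σ i, {p // p ∈ Q i}) =>
      ((j.1.2 ∩ q.2.1.toFinset).card : ℝ))
    (fun j => N.rhoP j.1.1 j.1.2) (fun j => N.rhoM j.1.1 j.1.2) (fun j => j.2.2) (fun j => j.2.2)
    (N.maxThroughput s t) (fun f hf hP hM =>
      N.sum_le_maxThroughput hst Q (fun i p hp => (hQm i p).1 hp) f hf
        (fun v S hS h => hP ⟨(v, S), hS, h⟩) (fun v S hS h => hM ⟨(v, S), hS, h⟩))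
  refine ⟨coverWeight y, coverWeight z, coverCost y, coverCost z, coverWeight_nonneg hy,
    coverWeight_nonneg hz, coverCost_nonneg hy, coverCost_nonneg hz, ?_,
    fun v τ T hT hτ => ?_, fun v τ T hT hτ => ?_, fun i p hp hpZ => ?_⟩
  · rwa [Finset.sum_add_distrib, sum_coverCost, sum_coverCost]
  · refine mul_le_coverCost (fun e v v' h h' => ?_) N.isPolymatroidOn_rhoP hy hT hτ
    exact (Finset.mem_filter.1 h).2.symm.trans (Finset.mem_filter.1 h').2
  · refine mul_le_coverCost (fun e v v' h h' => ?_) N.isPolymatroidOn_rhoM hz hT hτ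
    exact (Finset.mem_filter.1 h).2.symm.trans (Finset.mem_filter.1 h').2
  · have h1 := hyp ⟨i, p, (hQm i p).2 ⟨hp, hpZ⟩⟩
    simp only [sum_mul_coverWeight] at h1
    rwa [← List.sum_toFinset _ hp.nodup, Finset.sum_add_distrib]

end Flows

end DirPolyNet

theorem le_sum_floor {E : Type} {a b : E → ℝ} {S : ℝ} (hS : 0 ≤ S) {p : List E}
    (h : 1 ≤ (p.map fun e => a e + b e).sum) :
    S ≤ ((p.map fun e => ⌊S * a e⌋₊ + ⌊S * b e⌋₊).sum : ℕ) + 2 * (p.length : ℝ) := by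
  have key : S * (p.map fun e => a e + b e).sum ≤
      ((p.map fun e => ⌊S * a e⌋₊ + ⌊S * b e⌋₊).sum : ℕ) + 2 * (p.length : ℝ) := by
    clear h
    induction p with
    | nil => simp
    | cons e p ih =>
      have h1 := (Nat.lt_floor_add_one (S * a e)).le
      have h2 := (Nat.lt_floor_add_one (S * b e)).le
      simp only [List.map_cons, List.sum_cons, List.length_cons, Nat.cast_add, Nat.cast_one]
      linarith
  exact (le_mul_of_one_le_right hS h).trans key

namespace DirPolyNet

section Assembly

variable {V E : Type} [Fintype V] [Fintype E] [DecidableEq V] [DecidableEq E]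

omit [Fintype E] [DecidableEq E] in
theorem mul_le_of_floor {ρ : Finset E → ℝ} {U : Finset E} {a : E → ℝ} {c S : ℝ} (hS : 0 < S)
    (ha : ∀ e, 0 ≤ a e)
    (h : ∀ τ, ∀ T ⊆ U, (∀ e ∈ T, τ ≤ a e) → τ * ρ T ≤ c) (j : ℕ) {T : Finset E} (hT : T ⊆ U)
    (hj : ∀ e ∈ T, j ≤ ⌊S * a e⌋₊) : j * ρ T ≤ S * c := by
  have h1 := h (j / S) T hT fun e he => by
    rw [div_le_iff₀' hS]
    exact (Nat.cast_le.2 (hj e he)).trans (Nat.floor_le (mul_nonneg hS.le (ha e)))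
  calc j * ρ T = S * (j / S * ρ T) := by field_simp
    _ ≤ S * c := mul_le_mul_of_nonneg_left h1 hS.le

variable (N : DirPolyNet V E)

/-- The total cost of region growing, as a multiple of the maximum throughput. -/
noncomputable def GrowthScale.gap (P : GrowthScale) (n : ℕ) : ℝ :=
  16 * P.δ / (P.K + 1) +
    2 * (16 * P.δ) * (harmonic P.K : ℝ) * (n / (P.A₁ * P.h₀ : ℝ) + P.A₂ / (P.κ * P.h₀ : ℝ) +
      2 * P.B / (P.k * P.A₂ * P.h : ℝ)) +
    16 * (harmonic P.K : ℝ) * n ^ 2 / P.B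

theorem vertexPotential_le (E₀ : Finset E) (w : E → ℕ) (P : GrowthScale) (H : Finset E) (v : V) :
    N.vertexPotential E₀ w P H v ≤ Fintype.card V / (P.A₁ * P.h₀ : ℝ) + P.A₂ / (P.κ * P.h₀ : ℝ) +
      2 * P.B / (P.k * P.A₂ * P.h : ℝ) := by
  have h1 : ((N.reachSet H v).card : ℝ) ≤ Fintype.card V := Nat.cast_le.2 (Finset.card_le_univ _)
  unfold vertexPotential
  gcongr
  · exact min_le_right _ _
  · exact min_le_right _ _

theorem potential_le (E₀ : Finset E) (w : E → ℕ) {c : V → ℝ} (hc : ∀ v, 0 ≤ c v) (P : GrowthScale)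
    (H : Finset E) :
    N.potential E₀ w c P H + 16 * P.δ / (P.K + 1) * ∑ v, c v ≤
      P.gap (Fintype.card V) * ∑ v, c v := by
  have hH := harmonic_cast_nonneg P.K
  have h1 : ∑ v, c v * N.vertexPotential E₀ w P H v ≤
      (∑ v, c v) * (Fintype.card V / (P.A₁ * P.h₀ : ℝ) + P.A₂ / (P.κ * P.h₀ : ℝ) +
      2 * P.B / (P.k * P.A₂ * P.h : ℝ)) := by
    rw [Finset.sum_mul]
    exact Finset.sum_le_sum fun v _ =>
      mul_le_mul_of_nonneg_left (N.vertexPotential_le E₀ w P H v) (hc v)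
  have h2 : ((N.reachPairs H).card : ℝ) ≤ Fintype.card V ^ 2 := by
    have := Finset.card_le_univ (N.reachPairs H)
    rw [Fintype.card_prod, ← sq] at this
    exact_mod_cast this
  have hW : 0 ≤ ∑ v, c v := Finset.sum_nonneg fun v _ => hc v
  unfold potential GrowthScale.gap
  calc _ ≤ 2 * (16 * P.δ) * (harmonic P.K : ℝ) * ((∑ v, c v) * (Fintype.card V /
          (P.A₁ * P.h₀ : ℝ) + P.A₂ / (P.κ * P.h₀ : ℝ) + 2 * P.B / (P.k * P.A₂ * P.h : ℝ))) +
        16 * (harmonic P.K : ℝ) * (∑ v, c v) * (Fintype.card V : ℝ) ^ 2 / P.B +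
        16 * P.δ / (P.K + 1) * ∑ v, c v := by gcongr
    _ = _ := by ring

/-- Region growing on the optimal fractional cut. -/
theorem exists_multicut {ι : Type} [Fintype ι] {s t : ι → V} (hst : ∀ i, s i ≠ t i)
    {P : GrowthScale} {m : ℕ} (hP : P.Admissible (Fintype.card V)) (hB : P.B ≤ 2 ^ m)
    (hD : m * P.θ + 12 * P.δ + P.K + 2 * Fintype.card V ≤ 16 * P.δ) :
    ∃ F : Finset E, (∀ i, N.Separates F (s i) (t i)) ∧ ∃ W, 0 ≤ W ∧ W ≤ N.maxThroughput s t ∧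
      N.cutCost F ≤ P.gap (Fintype.card V) * W := by
  obtain ⟨a, b, cP, cM, ha, hb, hcP, hcM, hW, hlP, hlM, hpath⟩ := N.exists_fractional_cut hst
  have hc : ∀ v, 0 ≤ cP v + cM v := fun v => add_nonneg (hcP v) (hcM v)
  have hS : (0 : ℝ) < 16 * P.δ := by
    have := hP.δ_pos
    positivity
  set α : E → ℕ := fun e => ⌊16 * (P.δ : ℝ) * a e⌋₊ with hα
  set β : E → ℕ := fun e => ⌊16 * (P.δ : ℝ) * b e⌋₊ with hβ
  set A : Finset E := univ.filter fun e => P.K < α e with hA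
  set B : Finset E := univ.filter fun e => P.K < β e with hB'
  set F₁ : Finset E := (A ∪ B).filter fun e => N.tail e ≠ N.head e with hF₁
  set E₀ : Finset E := (univ.filter fun e => N.tail e ≠ N.head e) \ (N.freeEdges ∪ F₁) with hE₀
  have hE₀m : ∀ e, e ∈ E₀ ↔ N.tail e ≠ N.head e ∧ e ∉ N.freeEdges ∧ e ∉ F₁ := by
    intro e
    simp [hE₀]
  have hlev : ∀ v (j : ℕ), ∀ T ⊆ N.outE v, (∀ e ∈ T, j ≤ α e) →
      j * N.rhoP v T ≤ 16 * P.δ * cP v := fun v j T hT hj =>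
    mul_le_of_floor hS ha (hlP v) j hT hj
  have hlev' : ∀ v (j : ℕ), ∀ T ⊆ N.inE v, (∀ e ∈ T, j ≤ β e) →
      j * N.rhoM v T ≤ 16 * P.δ * cM v := fun v j T hT hj =>
    mul_le_of_floor hS hb (hlM v) j hT hj
  have hK : (0 : ℝ) < P.K + 1 := by positivity
  have hcheap₁ : N.Cheap F₁ (16 * P.δ / (P.K + 1) * ∑ v, (cP v + cM v)) := by
    refine ⟨fun e he => (Finset.mem_filter.1 he).2, A, B, Finset.filter_subset _ _, ?_⟩
    unfold splitCost
    rw [Finset.mul_sum]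
    refine Finset.sum_le_sum fun v _ => ?_
    rw [mul_add, div_mul_eq_mul_div, div_mul_eq_mul_div]
    refine add_le_add ?_ ?_
    · rw [le_div_iff₀' hK]
      exact_mod_cast hlev v (P.K + 1) _ Finset.inter_subset_left fun e he =>
        (Finset.mem_filter.1 (Finset.mem_inter.1 he).2).2
    · rw [le_div_iff₀' hK]
      exact_mod_cast hlev' v (P.K + 1) _ Finset.inter_subset_left fun e he =>
        (Finset.mem_filter.1 (Finset.mem_inter.1 he).2).2
  have hgrow : N.IsGrowable E₀ α β cP cM P m (16 * P.δ - 2 * Fintype.card V) s t := by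
    refine ⟨⟨fun e he => ((hE₀m e).1 he).1, fun e he => ?_, fun e he => ?_, hS, hcP, hcM,
      fun v j T hT hj => hlev v j T (hT.trans Finset.inter_subset_left) hj,
      fun v j T hT hj => hlev' v j T (hT.trans Finset.inter_subset_left) hj⟩, hP, hB,
      fun i p hp => ?_, by omega⟩
    · by_contra! hlt
      obtain ⟨h1, -, h2⟩ := (hE₀m e).1 he
      exact h2 (Finset.mem_filter.2 ⟨Finset.mem_union_left _
        (Finset.mem_filter.2 ⟨Finset.mem_univ _, hlt⟩), h1⟩)
    · by_contra! hlt
      obtain ⟨h1, -, h2⟩ := (hE₀m e).1 he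
      exact h2 (Finset.mem_filter.2 ⟨Finset.mem_union_right _
        (Finset.mem_filter.2 ⟨Finset.mem_univ _, hlt⟩), h1⟩)
    · obtain ⟨q, hq, hqE, hqp⟩ := hp.exists_path
      have h1 := le_sum_floor hS.le
        (hpath i q hq fun e he => ((hE₀m e).1 (hqE.2 e he)).2.1)
      have h2 : 16 * P.δ ≤ (q.map fun e => α e + β e).sum + 2 * q.length := by
        refine (Nat.cast_le (α := ℝ)).1 ?_
        rw [Nat.cast_add, Nat.cast_mul, Nat.cast_mul, Nat.cast_ofNat, Nat.cast_ofNat]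
        exact h1
      have h3 := IsPath.length_lt hq
      have h4 := sum_map_le_of_sublist (fun e => α e + β e) hqp
      omega
  obtain ⟨F, hF, hsep⟩ := hgrow.exists_cheap (H := E₀) subset_rfl
  refine ⟨N.freeEdges ∪ (F₁ ∪ F), fun i => ?_, ∑ v, (cP v + cM v),
    Finset.sum_nonneg fun v _ => hc v, hW, ?_⟩
  · rintro ⟨p, hp, hpF⟩
    obtain ⟨q, hq, hqp⟩ := N.exists_path_of_isWalk hp
    refine hsep i ⟨q, hq.1, fun e he => ?_⟩
    have h1 := hpF e (hqp.subset he)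
    simp only [Finset.mem_union, not_or] at h1
    exact Finset.mem_sdiff.2 ⟨(hE₀m e).2 ⟨hq.tail_ne_head he, h1.1, h1.2.1⟩, h1.2.2⟩
  · refine ((N.cheap_freeEdges.union (hcheap₁.union hF)).cutCost_le).trans ?_
    rw [zero_add, add_comm]
    exact N.potential_le E₀ _ hc P E₀

end Assembly

/-- The scale used for graphs on `n` vertices, where `q ^ 20` is about `n` and `m` is about
`log n`. -/
def GrowthScale.ofRoot (n q m : ℕ) : GrowthScale where
  K := n
  δ := 2 * n * (2 ^ 25 * m * q ^ 9)
  κ := 2 ^ 25 * m * q ^ 9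
  h := q ^ 7 * n
  h₀ := 2 ^ 24 * q ^ 9 * n
  k := q ^ 7
  A₁ := q ^ 11
  A₂ := q ^ 18
  B := q ^ 31
  θ := 2 ^ 27 * q ^ 9 * n

theorem GrowthScale.ofRoot_admissible {n q m : ℕ} (hn : 0 < n) (hq : 0 < q) (hm : 0 < m)
    (hnq : n ≤ 2 ^ 20 * q ^ 20) : (GrowthScale.ofRoot n q m).Admissible n := by
  have hq7 : 1 ≤ q ^ 7 := Nat.one_le_pow _ _ hq
  have hq9 : 1 ≤ q ^ 9 := Nat.one_le_pow _ _ hq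
  have h79 : q ^ 7 ≤ q ^ 9 := Nat.pow_le_pow_right hq (by norm_num)
  refine ⟨?_, ?_, ?_, ?_, ?_, ?_, ?_, ?_, ?_, fun i j hi hj => ?_⟩ <;> simp only [ofRoot] at *
  · positivity
  · positivity
  · positivity
  · positivity
  · positivity
  · positivity
  · positivity
  · gcongr
    omega
  · exact le_rfl
  · have hi' : i ≤ 2 ^ 21 * q ^ 2 := by
      refine Nat.le_of_mul_le_mul_left (hi.trans ?_) (show 0 < q ^ 18 by positivity)
      calc 2 * n ≤ 2 * (2 ^ 20 * q ^ 20) := by gcongr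
        _ = q ^ 18 * (2 ^ 21 * q ^ 2) := by ring
    have hj' : j ≤ q ^ 2 := by
      refine Nat.le_of_mul_le_mul_left ?_ (show 0 < q ^ 9 by positivity)
      calc q ^ 9 * j ≤ (2 ^ 25 * m) * (q ^ 9 * j) := Nat.le_mul_of_pos_left _ (by positivity)
        _ = 2 ^ 25 * m * q ^ 9 * j := by ring
        _ ≤ q ^ 11 := hj
        _ = q ^ 9 * q ^ 2 := by ring
    have h1 : 1 + i + j ≤ 2 ^ 22 * q ^ 2 := by
      have : 1 ≤ q ^ 2 := Nat.one_le_pow _ _ hq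
      omega
    have h2 : q ^ 7 * n + 2 * n * (q ^ 7 + 1) ≤ 5 * (q ^ 7 * n) := by nlinarith
    have h3 : n ≤ q ^ 9 * n := Nat.le_mul_of_pos_left _ hq9
    calc _ ≤ 5 * (q ^ 7 * n) * (2 ^ 22 * q ^ 2) + 2 * (2 ^ 24 * q ^ 9 * n) +
          3 * (2 * (q ^ 9 * n)) := by gcongr
      _ = 54525958 * (q ^ 9 * n) := by ring
      _ ≤ 2 ^ 27 * (q ^ 9 * n) := by gcongr; norm_num
      _ = _ := by ring

theorem GrowthScale.ofRoot_gap_le {n q m : ℕ} (hn : 0 < n) (hq : 0 < q) (hm : 0 < m)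
    (hnq : n ≤ 2 ^ 20 * q ^ 20) :
    (GrowthScale.ofRoot n q m).gap n ≤ 2 ^ 46 * m * (harmonic n : ℝ) * q ^ 9 := by
  have hn' : (1 : ℝ) ≤ n := by exact_mod_cast hn
  have hq' : (1 : ℝ) ≤ q := by exact_mod_cast hq
  have hm' : (1 : ℝ) ≤ m := by exact_mod_cast hm
  have hnq' : (n : ℝ) ≤ 2 ^ 20 * q ^ 20 := by exact_mod_cast hnq
  have hH : (1 : ℝ) ≤ (harmonic n : ℝ) := by
    have h1 : harmonic 1 ≤ harmonic n := by
      unfold harmonic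
      exact Finset.sum_le_sum_of_subset_of_nonneg (Finset.range_subset_range.2 hn)
        fun i _ _ => by positivity
    have h2 : harmonic 1 = 1 := by simp
    rw [h2] at h1
    exact_mod_cast h1
  simp only [gap, ofRoot, Nat.cast_mul, Nat.cast_pow, Nat.cast_ofNat]
  generalize (harmonic n : ℝ) = H at hH ⊢
  have e1 : 16 * (2 * (n : ℝ) * (2 ^ 25 * m * q ^ 9)) / (n + 1) ≤ 2 ^ 30 * m * H * q ^ 9 := by
    rw [div_le_iff₀ (by positivity)]
    calc 16 * (2 * (n : ℝ) * (2 ^ 25 * m * q ^ 9)) = 2 ^ 30 * m * 1 * q ^ 9 * n := by ring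
      _ ≤ 2 ^ 30 * m * H * q ^ 9 * (n + 1) := by gcongr; linarith
  have e2 : 2 * (16 * (2 * (n : ℝ) * (2 ^ 25 * m * q ^ 9))) * H *
      (n / (q ^ 11 * (2 ^ 24 * q ^ 9 * n))) ≤ 2 ^ 27 * m * H * q ^ 9 := by
    calc _ = 2 ^ 7 * m * H * q ^ 9 * (n / q ^ 20) := by field_simp; ring
      _ ≤ 2 ^ 7 * m * H * q ^ 9 * 2 ^ 20 := by
        gcongr
        rwa [div_le_iff₀ (by positivity)]
      _ = _ := by ring
  have e3 : 2 * (16 * (2 * (n : ℝ) * (2 ^ 25 * m * q ^ 9))) * H *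
      (q ^ 18 / (2 ^ 25 * m * q ^ 9 * (2 ^ 24 * q ^ 9 * n))) ≤ m * H * q ^ 9 := by
    calc _ = (1 / 2 ^ 18) * 1 * H * q ^ 9 := by field_simp; ring
      _ ≤ 1 * m * H * q ^ 9 := by gcongr; norm_num
      _ = _ := by ring
  have e4 : 2 * (16 * (2 * (n : ℝ) * (2 ^ 25 * m * q ^ 9))) * H *
      (2 * q ^ 31 / (q ^ 7 * q ^ 18 * (q ^ 7 * n))) ≤ 2 ^ 32 * m * H * q ^ 9 := by
    calc _ = 2 ^ 32 * m * H * q ^ 8 := by field_simp; ring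
      _ ≤ 2 ^ 32 * m * H * q ^ 9 := by gcongr; norm_num
  have e5 : 16 * H * (n : ℝ) ^ 2 / q ^ 31 ≤ 2 ^ 44 * m * H * q ^ 9 := by
    rw [div_le_iff₀ (by positivity)]
    calc 16 * H * (n : ℝ) ^ 2 ≤ 16 * H * (2 ^ 20 * q ^ 20) ^ 2 := by gcongr
      _ = 2 ^ 44 * 1 * H * q ^ 9 * q ^ 31 := by ring
      _ ≤ 2 ^ 44 * m * H * q ^ 9 * q ^ 31 := by gcongr
  have h0 : 0 ≤ m * H * (q : ℝ) ^ 9 := by positivity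
  linarith

end DirPolyNet

theorem exists_root (n : ℕ) (hn : 0 < n) : ∃ q, 0 < q ∧ q ^ 20 ≤ n ∧ n ≤ 2 ^ 20 * q ^ 20 := by
  set q := Nat.findGreatest (fun q => q ^ 20 ≤ n) n with hq
  have h1 : 1 ≤ q := Nat.le_findGreatest hn (by rwa [one_pow])
  refine ⟨q, h1, Nat.findGreatest_spec (P := fun q => q ^ 20 ≤ n) (m := 1) hn (by rwa [one_pow]), ?_⟩
  by_contra! h
  have h2 : (q + 1) ^ 20 ≤ n := by
    calc (q + 1) ^ 20 ≤ (2 * q) ^ 20 := Nat.pow_le_pow_left (by omega) _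
      _ = 2 ^ 20 * q ^ 20 := mul_pow _ _ _
      _ ≤ n := h.le
  have h3 : q + 1 ≤ n := (Nat.le_self_pow (by norm_num) _).trans h2
  have h4 : q + 1 ≤ q := Nat.le_findGreatest h3 h2
  omega

theorem bound_le_log_rpow {n q : ℕ} (hn : 2 ≤ n) (hqn : q ^ 20 ≤ n) :
    2 ^ 46 * ((2 * (Nat.log 2 n + 1) : ℕ) : ℝ) * (harmonic n : ℝ) * q ^ 9 ≤
      2 ^ 46 * 24 * (n : ℝ) ^ ((11 : ℝ) / 23) * (Real.log n) ^ (2 : ℝ) := by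
  have hn' : (1 : ℝ) ≤ n := by exact_mod_cast (by omega : 1 ≤ n)
  have hl : (1 / 2 : ℝ) ≤ Real.log n := by
    have h1 : Real.log 2 ≤ Real.log n := Real.log_le_log (by norm_num) (by exact_mod_cast hn)
    linarith [Real.log_two_gt_d9]
  have hm : ((2 * (Nat.log 2 n + 1) : ℕ) : ℝ) ≤ 8 * Real.log n := by
    have h1 : (2 : ℝ) ^ Nat.log 2 n ≤ n := by exact_mod_cast Nat.pow_log_le_self 2 (by omega)
    have h2 := Real.log_le_log (by positivity) h1
    rw [Real.log_pow] at h2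
    have h3 : (Nat.log 2 n : ℝ) * (1 / 2) ≤ Nat.log 2 n * Real.log 2 := by
      gcongr
      linarith [Real.log_two_gt_d9]
    push_cast
    linarith
  have hH : (harmonic n : ℝ) ≤ 3 * Real.log n := by
    linarith [harmonic_le_one_add_log n]
  have hq : (q : ℝ) ^ 9 ≤ (n : ℝ) ^ ((11 : ℝ) / 23) := by
    calc (q : ℝ) ^ 9 = ((q : ℝ) ^ 20) ^ ((9 : ℝ) / 20) := by
          rw [← Real.rpow_natCast, ← Real.rpow_natCast, ← Real.rpow_mul (by positivity)]
          norm_num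
      _ ≤ (n : ℝ) ^ ((9 : ℝ) / 20) := by
          gcongr
          exact_mod_cast hqn
      _ ≤ (n : ℝ) ^ ((11 : ℝ) / 23) := Real.rpow_le_rpow_of_exponent_le hn' (by norm_num)
  have hH0 := DirPolyNet.harmonic_cast_nonneg n
  calc _ ≤ 2 ^ 46 * (8 * Real.log n) * (3 * Real.log n) * (n : ℝ) ^ ((11 : ℝ) / 23) := by
        gcongr
    _ = _ := by rw [Real.rpow_two]; ring

/-- There are universal constants `C, c` such that in every directed
polymatroidal network on `n ≥ 2` nodes, for any multicommodity flow instance with `k`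
source-sink pairs, there is a feasible multicut `F` with
`ν(F) ≤ C · n^(11/23) · (log n)^c · β` where `β` is the maximum throughput flow. -/
theorem multicut_gap_directed :
    ∃ C c : ℝ, 0 < C ∧ 0 < c ∧
      ∀ (V E : Type) [Fintype V] [Fintype E] [DecidableEq V] [DecidableEq E]
        (N : DirPolyNet V E) (k : ℕ) (s t : Fin k → V),
        2 ≤ Fintype.card V →
        (∀ i, s i ≠ t i) →
        ∃ F : Finset E, (∀ i, N.Separates F (s i) (t i)) ∧
          N.cutCost F ≤ C * (Fintype.card V : ℝ) ^ ((11 : ℝ) / 23) *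
            (Real.log (Fintype.card V)) ^ c * N.maxThroughput s t := by
  refine ⟨2 ^ 46 * 24, 2, by norm_num, by norm_num, ?_⟩
  intro V E _ _ _ _ N k s t hn hst
  obtain ⟨q, hq, hqn, hnq⟩ := exists_root (Fintype.card V) (by omega)
  set n := Fintype.card V with hn_def
  have hP := GrowthScale.ofRoot_admissible (m := 2 * (Nat.log 2 n + 1)) (by omega) hq
    (by omega) hnq
  have hgap := GrowthScale.ofRoot_gap_le (m := 2 * (Nat.log 2 n + 1)) (by omega) hq
    (by omega) hnq
  obtain ⟨F, hF, W, hW0, hW, hcost⟩ := N.exists_multicut hst hP (m := 2 * (Nat.log 2 n + 1))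
    (by
      calc q ^ 31 ≤ q ^ 40 := Nat.pow_le_pow_right hq (by norm_num)
        _ = (q ^ 20) ^ 2 := by ring
        _ ≤ n ^ 2 := Nat.pow_le_pow_left hqn _
        _ ≤ (2 ^ (Nat.log 2 n + 1)) ^ 2 :=
          Nat.pow_le_pow_left (Nat.lt_pow_succ_log_self (by norm_num) n).le _
        _ = 2 ^ (2 * (Nat.log 2 n + 1)) := by rw [← pow_mul, mul_comm])
    (by
      have hm : 1 ≤ 2 * (Nat.log 2 n + 1) := by omega
      generalize 2 * (Nat.log 2 n + 1) = m at hm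
      have h1 : n ≤ m * q ^ 9 * n :=
        Nat.le_mul_of_pos_left _ (Nat.mul_pos hm (Nat.pow_pos hq))
      change m * (2 ^ 27 * q ^ 9 * n) + 12 * (2 * n * (2 ^ 25 * m * q ^ 9)) + n + 2 * n ≤
        16 * (2 * n * (2 ^ 25 * m * q ^ 9))
      calc _ = 14 * 2 ^ 26 * (m * q ^ 9 * n) + 3 * n := by ring
        _ ≤ 16 * 2 ^ 26 * (m * q ^ 9 * n) := by omega
        _ = _ := by ring)
  refine ⟨F, hF, hcost.trans ?_⟩
  have h1 := hgap.trans (bound_le_log_rpow hn hqn)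
  have h2 : 0 ≤ Real.log n := Real.log_natCast_nonneg n
  exact (mul_le_mul_of_nonneg_right h1 hW0).trans
    (mul_le_mul_of_nonneg_left hW (by positivity))
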